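/- Let ν be a nonempty partition of type 1 such that ν contains the rectangle (ν₁^{ν₁−1}) (the partition with ν₁ − 1 parts equal to ν₁). Then ν + (1) covers ν. -/

import Mathlib

/-- A partition, 0-indexed: `f i` is the `(i+1)`-st part. A partition is a weakly
decreasing, eventually zero function `ℕ → ℕ`. -/
def IsPartition (f : ℕ → ℕ) : Prop := Antitone f ∧ ∃ N, f N = 0

/-- The number of (nonzero) parts of a partition. -/
noncomputable def plen (f : ℕ → ℕ) : ℕ := sInf {n | f n = 0}

/-- The size (weight) of a partition: the sum of its parts. -/
noncomputable def psize (f : ℕ → ℕ) : ℕ := ∑ i ∈ Finset.range (plen f), f i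

/-- Containment of partitions: `subP f g` means `f ⊆ g`, i.e. `f i ≤ g i` for all `i`. -/
def subP (f g : ℕ → ℕ) : Prop := ∀ i, f i ≤ g i

/-- The conjugate partition: `conjP f j = #{i : f i > j}` (0-indexed). -/
noncomputable def conjP (f : ℕ → ℕ) : ℕ → ℕ := fun j => Nat.card {i : ℕ // j < f i}

/-- The square partition `(s^s)`. -/
def squareP (s : ℕ) : ℕ → ℕ := fun j => if j < s then s else 0

/-- The partition `(s^s, 1)`: `s` parts equal to `s` followed by a part equal to `1`. -/
def squareP1 (s : ℕ) : ℕ → ℕ := fun j => if j < s then s else if j = s then 1 else 0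

/-- The complement of `f` in the square `(m^m)`: the `(i+1)`-st part (0-indexed `i < m`)
is `m - f (m - 1 - i)`. -/
def complP (m : ℕ) (f : ℕ → ℕ) : ℕ → ℕ := fun i => if i < m then m - f (m - 1 - i) else 0

/-- `ν + (1)`: add one box at the end of the first row. -/
def addRow1 (f : ℕ → ℕ) : ℕ → ℕ := fun j => if j = 0 then f 0 + 1 else f j

/-- `(ν, 1)`: append a part equal to `1` after the last nonzero part. -/
noncomputable def addPart1 (f : ℕ → ℕ) : ℕ → ℕ :=
  fun j => if j < plen f then f j else if j = plen f then 1 else 0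

/-- Delete the first `k` columns of a partition. -/
def colDel (k : ℕ) (f : ℕ → ℕ) : ℕ → ℕ := fun j => f j - k

/-- Delete the first `s` rows of a partition. -/
def rowDel (s : ℕ) (f : ℕ → ℕ) : ℕ → ℕ := fun j => f (j + s)

/-- The sequence whose first `m` entries are given by `f` and whose subsequent entries
are given by `g`; used to form `(η^{c,m} + γ, σ)`. -/
def appendAfter (m : ℕ) (f g : ℕ → ℕ) : ℕ → ℕ := fun i => if i < m then f i else g (i - m)

/-- The cell in row `r`, column `c` (both 0-indexed) belongs to the skew diagram
`lam/alpha`. -/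
def inShape (lam alpha : ℕ → ℕ) (r c : ℕ) : Prop := alpha r ≤ c ∧ c < lam r

/-- A Littlewood–Richardson tableau of shape `lam/alpha` and content `beta`
(for each `k`, there are `beta k` entries equal to `k + 1`): a semistandard filling of
the skew diagram whose reverse reading word is a lattice permutation.  The lattice
condition is expressed by comparing, in every prefix of the reverse reading word ending
at a cell `(r, c)` (all cells in rows above `r`, together with the cells in row `r`
weakly to the right of column `c`), the number of entries `k + 2` with the number of
entries `k + 1`. -/
structure LRTableau (lam alpha beta : ℕ → ℕ) where
  entry : ℕ → ℕ → ℕ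
  zero_outside : ∀ r c, ¬ inShape lam alpha r c → entry r c = 0
  one_le : ∀ r c, inShape lam alpha r c → 1 ≤ entry r c
  row_weak : ∀ r c₁ c₂, c₁ ≤ c₂ → inShape lam alpha r c₁ → inShape lam alpha r c₂ →
    entry r c₁ ≤ entry r c₂
  col_strict : ∀ r₁ r₂ c, r₁ < r₂ → inShape lam alpha r₁ c → inShape lam alpha r₂ c →
    entry r₁ c < entry r₂ c
  content : ∀ k : ℕ,
    Nat.card {p : ℕ × ℕ // inShape lam alpha p.1 p.2 ∧ entry p.1 p.2 = k + 1} = beta k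
  lattice : ∀ r c k : ℕ, inShape lam alpha r c →
    Nat.card {p : ℕ × ℕ // inShape lam alpha p.1 p.2 ∧
        (p.1 < r ∨ (p.1 = r ∧ c ≤ p.2)) ∧ entry p.1 p.2 = k + 2} ≤
    Nat.card {p : ℕ × ℕ // inShape lam alpha p.1 p.2 ∧
        (p.1 < r ∨ (p.1 = r ∧ c ≤ p.2)) ∧ entry p.1 p.2 = k + 1}

open Classical in
/-- The Littlewood–Richardson coefficient `c^lam_{alpha, beta}`: the number of LR
tableaux of shape `lam/alpha` and content `beta`, or `0` if `alpha ⊄ lam`. -/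
noncomputable def LRcoeff (lam alpha beta : ℕ → ℕ) : ℕ :=
  if subP alpha lam then Nat.card (LRTableau lam alpha beta) else 0

/-- `mu` covers `nu`: for every integer `m ≥ μ₁ + ℓ(μ)` and every partition `lam`,
`c^lam_{ν^{c,m}, ν'} ≤ c^lam_{μ^{c,m}, μ'}`, i.e. `s_{μ'} s_{μ^c} - s_{ν'} s_{ν^c}`
is Schur-positive (complements taken in `(m^m)`). -/
def Covers (mu nu : ℕ → ℕ) : Prop :=
  ∀ m : ℕ, mu 0 + plen mu ≤ m → ∀ lam : ℕ → ℕ, IsPartition lam →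
    LRcoeff lam (complP m nu) (conjP nu) ≤ LRcoeff lam (complP m mu) (conjP mu)

/-- The partition `(i^{s+1}, i, i-1, ..., 2, 1)` (as a 0-indexed function). -/
def betaShape (i s : ℕ) : ℕ → ℕ := fun j => if j ≤ s + 1 then i else i + s + 1 - j

/-- A partition is of type 1 if it contains `(i, i, i-1, ..., 2, 1)` where `i` is its
first part. -/
def Type1 (nu : ℕ → ℕ) : Prop := IsPartition nu ∧ subP (betaShape (nu 0) 0) nu

/-- `nu = beta + (s^s) + alpha` (componentwise) is a type-2 decomposition: `s ≥ 1`,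
`alpha` is a nonempty partition with at most `s` parts, and `beta` is a (possibly empty)
partition containing `(i^{s+1}, i, i-1, ..., 2, 1)` where `i = beta 0`. -/
def IsType2Decomp (nu beta : ℕ → ℕ) (s : ℕ) (alpha : ℕ → ℕ) : Prop :=
  IsPartition beta ∧ IsPartition alpha ∧ 1 ≤ s ∧ alpha 0 ≠ 0 ∧ plen alpha ≤ s ∧
    subP (betaShape (beta 0) s) beta ∧ ∀ j, nu j = beta j + squareP s j + alpha j

/-- A partition is of type 2 if it admits a type-2 decomposition. -/
def Type2 (nu : ℕ → ℕ) : Prop := ∃ beta s alpha, IsType2Decomp nu beta s alpha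

/-- A self-conjugate partition. -/
def SelfConjugate (t : ℕ → ℕ) : Prop := ∀ j, conjP t j = t j

/-- A partition `nu` is corner-symmetric if for every outer corner of `nu` in row
`r + 1 ≥ 2` (1-indexed), i.e. every 0-indexed row `r ≥ 1` with `nu r < nu (r-1)`
(the corner cell lying in 0-indexed column `nu r`), there is a nonempty partition
`η ⊆ nu` such that the skew diagram `nu/η` is, up to translation, the Young diagram of
a self-conjugate partition, contains the cell `(r-1, nu r)` (0-indexed), and contains
no cell in any column of 0-indexed column index `< nu r`. -/
def CornerSymmetric (nu : ℕ → ℕ) : Prop :=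
  ∀ r : ℕ, 1 ≤ r → nu r < nu (r - 1) →
    ∃ η : ℕ → ℕ, IsPartition η ∧ subP η nu ∧ η 0 ≠ 0 ∧
      ∃ t : ℕ → ℕ, ∃ r0 c0 : ℕ, IsPartition t ∧ SelfConjugate t ∧
        (∀ a b : ℕ, (η a ≤ b ∧ b < nu a) ↔ (r0 ≤ a ∧ c0 ≤ b ∧ b - c0 < t (a - r0))) ∧
        η (r - 1) ≤ nu r ∧
        (∀ a b : ℕ, η a ≤ b → b < nu a → nu r ≤ b)

/-- The number of cells in the first `R` rows lying between the cuts `Q s` and `Q (s + 1)`. -/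
def cutCount (Q : ℕ → ℕ → ℕ) (s R : ℕ) : ℕ := ∑ r ∈ Finset.range R, (Q (s + 1) r - Q s r)

/-- The matrix of row cuts of a Littlewood–Richardson tableau: the entries of row `r` that
are at most `s` occupy the columns from `al r` up to `Q s r`. -/
structure IsCut (lam al be : ℕ → ℕ) (K M : ℕ) (Q : ℕ → ℕ → ℕ) : Prop where
  zero : ∀ r, Q 0 r = al r
  mono : ∀ s r, Q s r ≤ Q (s + 1) r
  top : ∀ s r, M ≤ s → Q s r = lam r
  col : ∀ s r, Q (s + 1) (r + 1) ≤ Q s r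
  content : ∀ s, cutCount Q s K = be s
  lat : ∀ s r, cutCount Q (s + 1) (r + 1) ≤ cutCount Q s r

theorem cutCount_zero (Q : ℕ → ℕ → ℕ) (s : ℕ) : cutCount Q s 0 = 0 := rfl

theorem cutCount_succ (Q : ℕ → ℕ → ℕ) (s r : ℕ) :
    cutCount Q s (r + 1) = cutCount Q s r + (Q (s + 1) r - Q s r) :=
  Finset.sum_range_succ _ _

theorem cutCount_mono (Q : ℕ → ℕ → ℕ) (s : ℕ) : Monotone (cutCount Q s) :=
  monotone_nat_of_le_succ fun r => by rw [cutCount_succ]; omega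

theorem natCard_rows_between (f g : ℕ → ℕ) (R : ℕ) (P : ℕ × ℕ → Prop)
    (hP : ∀ r c, P (r, c) ↔ r < R ∧ f r ≤ c ∧ c < g r) :
    Nat.card {p : ℕ × ℕ // P p} = ∑ r ∈ Finset.range R, (g r - f r) := by
  have e : {p : ℕ × ℕ // P p} ≃ ((Finset.range R).sigma fun r => Finset.Ico (f r) (g r)) :=
    { toFun := fun p => ⟨⟨p.1.1, p.1.2⟩, by
        have := (hP p.1.1 p.1.2).1 p.2
        simpa [Finset.mem_sigma] using this⟩
      invFun := fun p => ⟨(p.1.1, p.1.2), by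
        obtain ⟨⟨r, c⟩, h⟩ := p
        rw [hP]
        simpa [Finset.mem_sigma] using h⟩
      left_inv := fun p => rfl
      right_inv := fun p => rfl }
  rw [Nat.card_congr e, Nat.card_eq_fintype_card, Fintype.card_coe, Finset.card_sigma]
  simp

/-- A filling `en` is encoded by the cuts `Q`. -/
def Encodes (lam al : ℕ → ℕ) (en Q : ℕ → ℕ → ℕ) : Prop :=
  ∀ s r c, inShape lam al r c → (en r c ≤ s ↔ c < Q s r)

theorem Encodes.entry_eq_iff {lam al : ℕ → ℕ} {en Q : ℕ → ℕ → ℕ} (h : Encodes lam al en Q)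
    (hlo : ∀ s r, al r ≤ Q s r) (hhi : ∀ s r, Q s r ≤ lam r) (r c k : ℕ) :
    (inShape lam al r c ∧ en r c = k + 1) ↔ (Q k r ≤ c ∧ c < Q (k + 1) r) := by
  constructor
  · rintro ⟨h1, h2⟩
    have a := h k r c h1
    have b := h (k + 1) r c h1
    omega
  · rintro ⟨h1, h2⟩
    have h3 : inShape lam al r c := ⟨(hlo k r).trans h1, h2.trans_le (hhi _ r)⟩
    have a := h k r c h3
    have b := h (k + 1) r c h3
    exact ⟨h3, by omega⟩

theorem Encodes.natCard_entry_eq {lam al : ℕ → ℕ} {en Q : ℕ → ℕ → ℕ} (h : Encodes lam al en Q)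
    (hlo : ∀ s r, al r ≤ Q s r) (hhi : ∀ s r, Q s r ≤ lam r) {K : ℕ}
    (hK : ∀ r, K ≤ r → lam r = 0) (k : ℕ) :
    Nat.card {p : ℕ × ℕ // inShape lam al p.1 p.2 ∧ en p.1 p.2 = k + 1} = cutCount Q k K := by
  refine natCard_rows_between _ _ _ _ fun r c => ?_
  change (inShape lam al r c ∧ en r c = k + 1) ↔ _
  rw [h.entry_eq_iff hlo hhi]
  have a := hK r
  have b := hhi (k + 1) r
  constructor <;> intro <;> omega

theorem Encodes.natCard_prefix {lam al : ℕ → ℕ} {en Q : ℕ → ℕ → ℕ} (h : Encodes lam al en Q)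
    (hlo : ∀ s r, al r ≤ Q s r) (hhi : ∀ s r, Q s r ≤ lam r) (r c k : ℕ) :
    Nat.card {p : ℕ × ℕ // inShape lam al p.1 p.2 ∧
      (p.1 < r ∨ (p.1 = r ∧ c ≤ p.2)) ∧ en p.1 p.2 = k + 1} =
    cutCount Q k r + (Q (k + 1) r - max c (Q k r)) := by
  rw [natCard_rows_between (fun x => if x < r then Q k x else max c (Q k x))
    (fun x => Q (k + 1) x) (r + 1), Finset.sum_range_succ]
  · simp only [lt_irrefl, if_false, cutCount]
    congr 1
    refine Finset.sum_congr rfl fun x hx => ?_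
    rw [if_pos (Finset.mem_range.1 hx)]
  · intro x y
    have a := h.entry_eq_iff hlo hhi x y k
    change (inShape lam al x y ∧ (x < r ∨ (x = r ∧ c ≤ y)) ∧ en x y = k + 1) ↔ _
    have : (inShape lam al x y ∧ (x < r ∨ (x = r ∧ c ≤ y)) ∧ en x y = k + 1) ↔
        ((x < r ∨ (x = r ∧ c ≤ y)) ∧ (inShape lam al x y ∧ en x y = k + 1)) := by tauto
    rw [this, a]
    split_ifs <;> constructor <;> intro <;> omega

theorem exists_encodes {lam al be : ℕ → ℕ} (hs : subP al lam) (T : LRTableau lam al be) :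
    ∃ Q : ℕ → ℕ → ℕ, (∀ s r, al r ≤ Q s r) ∧ (∀ s r, Q s r ≤ lam r) ∧
      Encodes lam al T.entry Q := by
  have key : ∀ s r, ∃ q, al r ≤ q ∧ q ≤ lam r ∧
      ∀ c, inShape lam al r c → (T.entry r c ≤ s ↔ c < q) := by
    classical
    intro s r
    have ex : ∃ q, al r ≤ q ∧ (lam r ≤ q ∨ s < T.entry r q) := ⟨lam r, hs r, Or.inl le_rfl⟩
    have hq := Nat.find_spec ex
    have hmin := fun c => Nat.find_min (H := ex) (m := c)
    have hle : Nat.find ex ≤ lam r := Nat.find_min' ex ⟨hs r, Or.inl le_rfl⟩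
    generalize Nat.find ex = q at hq hmin hle
    refine ⟨q, hq.1, hle, fun c hc => ?_⟩
    constructor
    · intro h
      by_contra! hlt
      rcases hq.2 with h' | h'
      · have := hc.2
        omega
      · have := T.row_weak r q c hlt ⟨hq.1, hlt.trans_lt hc.2⟩ hc
        omega
    · intro h
      by_contra! hlt
      exact hmin c h ⟨hc.1, Or.inr hlt⟩
  choose Q h1 h2 h3 using key
  exact ⟨Q, h1, h2, fun s r c => h3 s r c⟩

theorem LRTableau.isCut {lam al be : ℕ → ℕ} {K M : ℕ} (hlam : Antitone lam) (hal : Antitone al)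
    (hK : ∀ r, K ≤ r → lam r = 0) (hM : ∀ s, M ≤ s → be s = 0)
    (T : LRTableau lam al be) {Q : ℕ → ℕ → ℕ}
    (hlo : ∀ s r, al r ≤ Q s r) (hhi : ∀ s r, Q s r ≤ lam r)
    (hE : Encodes lam al T.entry Q) : IsCut lam al be K M Q := by
  have mono : ∀ s r, Q s r ≤ Q (s + 1) r := by
    intro s r
    by_contra! h
    have hc : inShape lam al r (Q (s + 1) r) := ⟨hlo _ r, h.trans_le (hhi _ r)⟩
    have a := hE s r _ hc
    have b := hE (s + 1) r _ hc
    omega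
  have content : ∀ s, cutCount Q s K = be s := fun s => by
    rw [← hE.natCard_entry_eq hlo hhi hK, T.content]
  refine ⟨fun r => ?_, mono, fun s r hs' => ?_, fun s r => ?_, content, fun s r => ?_⟩
  · by_contra h
    have h' : al r < Q 0 r := lt_of_le_of_ne (hlo 0 r) (Ne.symm h)
    have hc : inShape lam al r (al r) := ⟨le_rfl, h'.trans_le (hhi _ r)⟩
    have a := hE 0 r _ hc
    have b := T.one_le r _ hc
    omega
  · have step : ∀ t, M ≤ t → Q (t + 1) r = Q t r := by
      intro t ht
      rcases lt_or_ge r K with hr | hr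
      · have h0 : cutCount Q t K = 0 := by rw [content, hM t ht]
        have := (Finset.sum_eq_zero_iff.1 h0) r (Finset.mem_range.2 hr)
        have := mono t r
        omega
      · have := hK r hr
        have := hhi t r
        have := hhi (t + 1) r
        omega
    have const : ∀ t, Q (s + t) r = Q s r := by
      intro t
      induction t with
      | zero => rfl
      | succ t ih => rw [← add_assoc, step _ (by omega), ih]
    by_contra h
    have h' : Q s r < lam r := lt_of_le_of_ne (hhi s r) h
    have hc : inShape lam al r (Q s r) := ⟨hlo _ r, h'⟩
    have a := hE (s + T.entry r (Q s r)) r _ hc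
    rw [const] at a
    omega
  · by_contra! h
    have hlt := h.trans_le (hhi (s + 1) (r + 1))
    have hc1 : inShape lam al (r + 1) (Q s r) := ⟨(hal (Nat.le_succ r)).trans (hlo _ _), hlt⟩
    have hc0 : inShape lam al r (Q s r) := ⟨hlo _ _, hlt.trans_le (hlam (Nat.le_succ r))⟩
    have a := hE s r _ hc0
    have b := hE (s + 1) (r + 1) _ hc1
    have d := T.col_strict r (r + 1) _ (Nat.lt_succ_self r) hc0 hc1
    omega
  · induction r with
    | zero =>
      rw [cutCount_succ, cutCount_zero]
      by_contra! h
      have hc : inShape lam al 0 (Q (s + 1) 0) :=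
        ⟨hlo _ _, by have := hhi (s + 1 + 1) 0; omega⟩
      have L := T.lattice 0 _ s hc
      rw [hE.natCard_prefix hlo hhi, hE.natCard_prefix hlo hhi] at L
      simp only [cutCount_zero] at L h
      omega
    | succ r ih =>
      by_cases hn : Q (s + 1) (r + 1) < Q (s + 1 + 1) (r + 1)
      · have hc : inShape lam al (r + 1) (Q (s + 1) (r + 1)) :=
          ⟨hlo _ _, hn.trans_le (hhi _ _)⟩
        have L := T.lattice _ _ s hc
        rw [hE.natCard_prefix hlo hhi, hE.natCard_prefix hlo hhi] at L
        rw [cutCount_succ]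
        omega
      · rw [cutCount_succ]
        have := cutCount_succ Q s r
        omega

theorem IsCut.mono_left {lam al be : ℕ → ℕ} {K M : ℕ} {Q : ℕ → ℕ → ℕ}
    (h : IsCut lam al be K M Q) (r : ℕ) : Monotone fun s => Q s r :=
  monotone_nat_of_le_succ fun s => h.mono s r

theorem IsCut.antitone_right {lam al be : ℕ → ℕ} {K M : ℕ} {Q : ℕ → ℕ → ℕ}
    (h : IsCut lam al be K M Q) (s : ℕ) : Antitone (Q s) :=
  antitone_nat_of_succ_le fun r => (h.mono s (r + 1)).trans (h.col s r)

theorem IsCut.le_top {lam al be : ℕ → ℕ} {K M : ℕ} {Q : ℕ → ℕ → ℕ}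
    (h : IsCut lam al be K M Q) (s r : ℕ) : Q s r ≤ lam r := by
  rw [← h.top (max M s) r (le_max_left _ _)]
  exact h.mono_left r (le_max_right _ _)

theorem IsCut.le_zero {lam al be : ℕ → ℕ} {K M : ℕ} {Q : ℕ → ℕ → ℕ}
    (h : IsCut lam al be K M Q) (s r : ℕ) : al r ≤ Q s r := by
  rw [← h.zero r]
  exact h.mono_left r (Nat.zero_le _)

theorem IsCut.exists_tableau {lam al be : ℕ → ℕ} {K M : ℕ} {Q : ℕ → ℕ → ℕ}
    (h : IsCut lam al be K M Q) (hK : ∀ r, K ≤ r → lam r = 0) :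
    ∃ T : LRTableau lam al be, Encodes lam al T.entry Q := by
  classical
  have ex : ∀ r c, inShape lam al r c → ∃ s, c < Q s r := fun r c hc =>
    ⟨M, by rw [h.top M r le_rfl]; exact hc.2⟩
  let en : ℕ → ℕ → ℕ := fun r c => if hc : inShape lam al r c then Nat.find (ex r c hc) else 0
  have hE : Encodes lam al en Q := by
    intro s r c hc
    simp only [en, dif_pos hc]
    constructor
    · intro hle
      exact (Nat.find_spec (ex r c hc)).trans_le (h.mono_left r hle)
    · exact fun hlt => Nat.find_min' _ hlt
  have hlo := h.le_zero
  have hhi := h.le_top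
  refine ⟨⟨en, fun r c hc => by simp only [en, dif_neg hc], fun r c hc => ?_,
    fun r c₁ c₂ hle h1 h2 => ?_, fun r₁ r₂ c hlt h1 h2 => ?_, fun k => ?_,
    fun r c k hc => ?_⟩, hE⟩
  · have a := hE 0 r c hc
    have b := h.zero r
    have d := hc.1
    omega
  · have a := hE (en r c₂) r c₁ h1
    have b := hE (en r c₂) r c₂ h2
    omega
  · obtain ⟨d, rfl⟩ := Nat.exists_eq_add_of_lt hlt
    have b := hE (en (r₁ + d + 1) c) _ c h2
    have z := hE 0 _ c h2
    have z' := h.zero (r₁ + d + 1)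
    have z'' := h2.1
    obtain ⟨e, he⟩ : ∃ e, en (r₁ + d + 1) c = e + 1 :=
      Nat.exists_eq_succ_of_ne_zero (by omega)
    rw [he] at b ⊢
    have b' := h.col e (r₁ + d)
    have b'' := h.antitone_right e (Nat.le_add_right r₁ d)
    have a := hE e r₁ c h1
    omega
  · rw [hE.natCard_entry_eq hlo hhi hK, h.content]
  · rw [hE.natCard_prefix hlo hhi, hE.natCard_prefix hlo hhi]
    have a := h.lat k r
    rw [cutCount_succ] at a
    omega

theorem LRTableau.ext_entry {lam al be : ℕ → ℕ} {T T' : LRTableau lam al be}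
    (h : T.entry = T'.entry) : T = T' := by
  cases T
  cases T'
  cases h
  rfl

theorem LRTableau.eq_of_encodes {lam al be : ℕ → ℕ} {T T' : LRTableau lam al be}
    {Q : ℕ → ℕ → ℕ} (h : Encodes lam al T.entry Q) (h' : Encodes lam al T'.entry Q) :
    T = T' := by
  refine LRTableau.ext_entry (funext fun r => funext fun c => ?_)
  by_cases hc : inShape lam al r c
  · have a := h (T.entry r c) r c hc
    have a' := h' (T.entry r c) r c hc
    have b := h (T'.entry r c) r c hc
    have b' := h' (T'.entry r c) r c hc
    omega
  · rw [T.zero_outside r c hc, T'.zero_outside r c hc]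

theorem Encodes.cut_unique {lam al : ℕ → ℕ} {en Q Q' : ℕ → ℕ → ℕ}
    (hlo : ∀ s r, al r ≤ Q s r) (hhi : ∀ s r, Q s r ≤ lam r)
    (hlo' : ∀ s r, al r ≤ Q' s r) (hhi' : ∀ s r, Q' s r ≤ lam r)
    (h : Encodes lam al en Q) (h' : Encodes lam al en Q') : Q = Q' := by
  funext s r
  have h1 := hlo s r
  have h2 := hhi s r
  have h3 := hlo' s r
  have h4 := hhi' s r
  rcases lt_trichotomy (Q s r) (Q' s r) with hlt | heq | hlt
  · have a := h s r (Q s r) ⟨h1, by omega⟩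
    have b := h' s r (Q s r) ⟨h1, by omega⟩
    omega
  · exact heq
  · have a := h s r (Q' s r) ⟨h3, by omega⟩
    have b := h' s r (Q' s r) ⟨h3, by omega⟩
    omega

theorem LRTableau.finite {lam al be : ℕ → ℕ} {K M : ℕ} (hlam : Antitone lam) (hal : Antitone al)
    (hs : subP al lam) (hK : ∀ r, K ≤ r → lam r = 0) (hM : ∀ s, M ≤ s → be s = 0) :
    Finite (LRTableau lam al be) := by
  have bound : ∀ (T : LRTableau lam al be) r c, T.entry r c < M + 1 := by
    intro T r c
    by_cases hc : inShape lam al r c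
    · obtain ⟨Q, hlo, hhi, hE⟩ := exists_encodes hs T
      have hQ := T.isCut hlam hal hK hM hlo hhi hE
      have a := hE M r c hc
      have b := hQ.top M r le_rfl
      have d := hc.2
      omega
    · rw [T.zero_outside r c hc]
      omega
  refine Finite.of_injective
    (fun (T : LRTableau lam al be) (r : Fin K) (c : Fin (lam 0)) =>
      (⟨T.entry r c, bound T r c⟩ : Fin (M + 1))) fun T T' hT => ?_
  refine LRTableau.ext_entry (funext fun r => funext fun c => ?_)
  by_cases hc : inShape lam al r c
  · have hr : r < K := by
      by_contra! hr
      have := hK r hr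
      have := hc.2
      omega
    have hc0 : c < lam 0 := hc.2.trans_le (hlam (Nat.zero_le r))
    have := congrFun (congrFun hT ⟨r, hr⟩) ⟨c, hc0⟩
    simpa using this
  · rw [T.zero_outside r c hc, T'.zero_outside r c hc]

theorem LRcoeff_le_of_cut_relation {lam al be al' be' : ℕ → ℕ} {K M M' : ℕ} (hlam : Antitone lam)
    (hal : Antitone al) (hal' : Antitone al') (hsub : subP al' al)
    (hK : ∀ r, K ≤ r → lam r = 0) (hM : ∀ s, M ≤ s → be s = 0) (hM' : ∀ s, M' ≤ s → be' s = 0)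
    (Rel : (ℕ → ℕ → ℕ) → (ℕ → ℕ → ℕ) → Prop)
    (hex : subP al lam → ∀ Q, IsCut lam al be K M Q →
      ∃ Q', IsCut lam al' be' K M' Q' ∧ Rel Q Q')
    (hinj : subP al lam → ∀ Q₁ Q₂ Q', IsCut lam al be K M Q₁ → IsCut lam al be K M Q₂ →
      Rel Q₁ Q' → Rel Q₂ Q' → Q₁ = Q₂) :
    LRcoeff lam al be ≤ LRcoeff lam al' be' := by
  unfold LRcoeff
  by_cases hs : subP al lam
  · have hs' : subP al' lam := fun r => (hsub r).trans (hs r)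
    rw [if_pos hs, if_pos hs']
    have := LRTableau.finite (be := be') hlam hal' hs' hK hM'
    have key : ∀ T : LRTableau lam al be, ∃ T' : LRTableau lam al' be', ∃ Q Q',
        IsCut lam al be K M Q ∧ IsCut lam al' be' K M' Q' ∧ Encodes lam al T.entry Q ∧
        Encodes lam al' T'.entry Q' ∧ Rel Q Q' := by
      intro T
      obtain ⟨Q, hlo, hhi, hE⟩ := exists_encodes hs T
      have hQ := T.isCut hlam hal hK hM hlo hhi hE
      obtain ⟨Q', hQ', hR⟩ := hex hs Q hQ
      obtain ⟨T', hT'⟩ := hQ'.exists_tableau hK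
      exact ⟨T', Q, Q', hQ, hQ', hE, hT', hR⟩
    choose F A A' h1 h2 h3 h4 h5 using key
    refine Nat.card_le_card_of_injective F fun T₁ T₂ hT => ?_
    have e' : A' T₁ = A' T₂ := by
      refine Encodes.cut_unique (h2 T₁).le_zero (h2 T₁).le_top (h2 T₂).le_zero (h2 T₂).le_top
        (h4 T₁) ?_
      rw [hT]
      exact h4 T₂
    have e : A T₁ = A T₂ := hinj hs _ _ (A' T₁) (h1 T₁) (h1 T₂) (h5 T₁) (e' ▸ h5 T₂)
    exact LRTableau.eq_of_encodes (h3 T₁) (e ▸ h3 T₂)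
  · rw [if_neg hs]
    exact Nat.zero_le _

/-- Remove, for each `s ≤ i`, one cell from the cut `Q s` in row `rho s`: this lowers by one
unit the letter sitting at the end of a strip, and adds a letter `i + 1`. -/
def moveCut (i : ℕ) (rho : ℕ → ℕ) (Q : ℕ → ℕ → ℕ) : ℕ → ℕ → ℕ :=
  fun s r => Q s r - if s ≤ i ∧ rho s = r then 1 else 0

/-- The conditions on `rho` under which `moveCut i rho Q` is again the cut matrix of a
Littlewood–Richardson tableau. -/
structure ValidMove (K i : ℕ) (Q : ℕ → ℕ → ℕ) (rho : ℕ → ℕ) : Prop where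
  bound : ∀ s, s ≤ i → rho s < K
  pos : ∀ s, s ≤ i → 1 ≤ Q s (rho s)
  mono : ∀ s, s < i → rho (s + 1) ≠ rho s → Q s (rho (s + 1)) < Q (s + 1) (rho (s + 1))
  col : ∀ s, s ≤ i → (s = i ∨ rho (s + 1) ≠ rho s + 1) → Q (s + 1) (rho s + 1) < Q s (rho s)
  lat : ∀ s r, s + 2 ≤ i →
    cutCount Q (s + 1) (r + 1) + (if rho (s + 1) ≤ r then 1 else 0) +
        (if rho (s + 1) < r then 1 else 0) ≤
      cutCount Q s r + (if rho s < r then 1 else 0) + if rho (s + 2) ≤ r then 1 else 0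
  lat_last : ∀ s r, s + 1 = i →
    (if rho i ≤ r then 1 else 0) + (if rho i < r then 1 else 0) ≤
      cutCount Q s r + if rho s < r then 1 else 0

theorem ValidMove.count_lt {lam al be : ℕ → ℕ} {K i : ℕ} {Q : ℕ → ℕ → ℕ} {rho : ℕ → ℕ}
    (h : IsCut lam al be K i Q) (v : ValidMove K i Q rho) {s : ℕ} (hs : s < i) (r : ℕ) :
    cutCount (moveCut i rho Q) s r + (if rho (s + 1) < r then 1 else 0) =
      cutCount Q s r + if rho s < r then 1 else 0 := by
  induction r with
  | zero => simp [cutCount_zero]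
  | succ r ih =>
    rw [cutCount_succ, cutCount_succ]
    have h1 : rho s = r → 1 ≤ Q s r := by
      rintro rfl
      exact v.pos s hs.le
    have h2 : rho (s + 1) = r → rho s ≠ r → Q s r < Q (s + 1) r := by
      rintro rfl hne
      exact v.mono s hs hne.symm
    have h3 := h.mono s r
    have h4 : rho (s + 1) = r → 1 ≤ Q (s + 1) r := by
      rintro rfl
      exact v.pos (s + 1) hs
    simp only [moveCut, hs.le, Nat.succ_le_of_lt hs, true_and] at ih ⊢
    generalize rho s = x at *
    generalize rho (s + 1) = y at *
    generalize Q s r = q at *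
    generalize Q (s + 1) r = q' at *
    split_ifs at ih ⊢ <;> omega

theorem IsCut.count_top {lam al be : ℕ → ℕ} {K i : ℕ} {Q : ℕ → ℕ → ℕ}
    (h : IsCut lam al be K i Q) {s : ℕ} (hs : i ≤ s) (r : ℕ) : cutCount Q s r = 0 :=
  Finset.sum_eq_zero fun x _ => by rw [h.top s x hs, h.top (s + 1) x (by omega), Nat.sub_self]

theorem ValidMove.count_self {lam al be : ℕ → ℕ} {K i : ℕ} {Q : ℕ → ℕ → ℕ} {rho : ℕ → ℕ}
    (h : IsCut lam al be K i Q) (v : ValidMove K i Q rho) (r : ℕ) :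
    cutCount (moveCut i rho Q) i r = if rho i < r then 1 else 0 := by
  induction r with
  | zero => simp [cutCount_zero]
  | succ r ih =>
    rw [cutCount_succ, ih]
    have h1 : rho i = r → 1 ≤ Q i r := by
      rintro rfl
      exact v.pos i le_rfl
    have h2 := h.top i r le_rfl
    have h3 := h.top (i + 1) r (Nat.le_succ i)
    have h4 : ¬ (i + 1 ≤ i) := by omega
    simp only [moveCut, le_refl, true_and, h4, false_and, if_false]
    split_ifs <;> omega

theorem ValidMove.count_gt {lam al be : ℕ → ℕ} {K i : ℕ} {Q : ℕ → ℕ → ℕ} {rho : ℕ → ℕ}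
    (h : IsCut lam al be K i Q) {s : ℕ} (hs : i < s) (r : ℕ) :
    cutCount (moveCut i rho Q) s r = 0 :=
  Finset.sum_eq_zero fun x _ => by
    have h1 := h.top s x hs.le
    have h2 := h.top (s + 1) x (by omega)
    have h3 : ¬ s ≤ i := by omega
    have h4 : ¬ s + 1 ≤ i := by omega
    simp only [moveCut, h3, h4, false_and, if_false]
    omega

theorem ValidMove.isCut {lam al al' be be' : ℕ → ℕ} {K i : ℕ} {Q : ℕ → ℕ → ℕ} {rho : ℕ → ℕ}
    (h : IsCut lam al be K i Q) (v : ValidMove K i Q rho)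
    (hal : ∀ r, al' r = al r - if rho 0 = r then 1 else 0)
    (hbe : ∀ s, be' s = be s + if s = i then 1 else 0) :
    IsCut lam al' be' K (i + 1) (moveCut i rho Q) := by
  refine ⟨fun r => ?_, fun s r => ?_, fun s r hs => ?_, fun s r => ?_, fun s => ?_,
    fun s r => ?_⟩
  · simp only [moveCut, h.zero, hal, Nat.zero_le, true_and]
  · have h1 := h.mono s r
    have h2 := v.mono s
    simp only [moveCut]
    by_cases e : s + 1 ≤ i ∧ rho (s + 1) = r
    · by_cases e' : s ≤ i ∧ rho s = r
      · rw [if_pos e, if_pos e']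
        omega
      · have := h2 e.1 (fun he => e' ⟨by omega, by rw [← he]; exact e.2⟩)
        rw [e.2] at this
        rw [if_pos e, if_neg e']
        omega
    · rw [if_neg e]
      omega
  · have : ¬ s ≤ i := by omega
    simp only [moveCut, this, false_and, if_false]
    rw [h.top s r (by omega)]
    rfl
  · have h1 := h.col s r
    have h2 := v.col s
    simp only [moveCut]
    by_cases e : s ≤ i ∧ rho s = r
    · rw [if_pos e]
      by_cases e' : s + 1 ≤ i ∧ rho (s + 1) = r + 1
      · rw [if_pos e']
        omega
      · have := h2 e.1 (by rw [e.2]; by_contra! hc; exact e' ⟨by omega, hc.2⟩)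
        rw [e.2] at this
        rw [if_neg e']
        omega
    · rw [if_neg e]
      omega
  · rw [hbe, ← h.content s]
    rcases lt_trichotomy s i with hs | hs | hs
    · have h1 := v.count_lt h hs K
      have h2 := v.bound s hs.le
      have h3 := v.bound (s + 1) hs
      simp only [h2, h3, if_true] at h1
      rw [if_neg hs.ne]
      omega
    · subst hs
      rw [v.count_self h, h.count_top le_rfl, if_pos (v.bound s le_rfl), if_pos rfl]
    · rw [ValidMove.count_gt h hs, h.count_top hs.le, if_neg hs.ne']
  · rcases lt_trichotomy (s + 1) i with hs | hs | hs
    · have h1 := v.count_lt h hs (r + 1)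
      have h2 := v.count_lt h (show s < i by omega) r
      have h3 := v.lat s r hs
      simp only [Nat.lt_succ_iff] at h1
      have e : s + 1 + 1 = s + 2 := rfl
      rw [e] at h1
      omega
    · have h1 := v.count_self h (r + 1)
      have h2 := v.count_lt h (show s < i by omega) r
      have h3 := v.lat_last s r hs
      simp only [Nat.lt_add_one_iff] at h1
      rw [hs] at h2 ⊢
      omega
    · rw [ValidMove.count_gt h hs]
      exact Nat.zero_le _

theorem moveCut_injective {K i : ℕ} {Q₁ Q₂ : ℕ → ℕ → ℕ} {rho rho' : ℕ → ℕ}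
    (v₁ : ValidMove K i Q₁ rho) (v₂ : ValidMove K i Q₂ rho')
    (hrho : ∀ s, s ≤ i → rho s = rho' s)
    (he : moveCut i rho Q₁ = moveCut i rho' Q₂) : Q₁ = Q₂ := by
  funext s r
  have h := congrFun (congrFun he s) r
  simp only [moveCut] at h
  by_cases e : s ≤ i ∧ rho s = r
  · have e' : s ≤ i ∧ rho' s = r := ⟨e.1, by rw [← hrho s e.1]; exact e.2⟩
    have h1 := v₁.pos s e.1
    have h2 := v₂.pos s e.1
    rw [e.2] at h1
    rw [e'.2] at h2
    rw [if_pos e, if_pos e'] at h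
    omega
  · have e' : ¬ (s ≤ i ∧ rho' s = r) := fun e' => e ⟨e'.1, by rw [hrho s e'.1]; exact e'.2⟩
    rw [if_neg e, if_neg e'] at h
    exact h

theorem IsCut.count_le {lam al be : ℕ → ℕ} {K M : ℕ} {Q : ℕ → ℕ → ℕ}
    (h : IsCut lam al be K M Q) (hK : ∀ r, K ≤ r → lam r = 0) (s r : ℕ) :
    cutCount Q s r ≤ be s := by
  rw [← h.content s]
  rcases le_total r K with hr | hr
  · exact cutCount_mono Q s hr
  · refine (Finset.sum_subset (Finset.range_mono hr) fun x _ hx => ?_).ge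
    have h1 := h.le_top (s + 1) x
    have h2 := hK x (by simpa using hx)
    omega

/-- The situation arising from a skew shape whose inner shape is the complement of a
partition with first part `j + 1` in a square of side `b + j + 1`. -/
structure CutSetup (b j K : ℕ) (lam al be : ℕ → ℕ) (Q : ℕ → ℕ → ℕ) : Prop where
  cut : IsCut lam al be K (j + 1) Q
  lam_anti : Antitone lam
  lam_zero : ∀ r, K ≤ r → lam r = 0
  al_last : al (b + j) = b
  al_zero : ∀ r, b + j < r → al r = 0
  be_zero : be 0 < b
  be_min : ∀ s, s ≤ j → be j ≤ be s
  be_two : 2 ≤ be j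
  be_large : j ≤ be j
  rows : b + j + 2 < K

theorem CutSetup.last_row {b j K : ℕ} {lam al be : ℕ → ℕ} {Q : ℕ → ℕ → ℕ}
    (c : CutSetup b j K lam al be Q) (s : ℕ) : b ≤ Q s (b + j) := by
  have h := c.cut.le_zero s (b + j)
  rwa [c.al_last] at h

theorem CutSetup.next_row {b j K : ℕ} {lam al be : ℕ → ℕ} {Q : ℕ → ℕ → ℕ}
    (c : CutSetup b j K lam al be Q) (s : ℕ) : Q s (b + j + 1) < b := by
  have key : cutCount Q s (b + j + 2) + Q s (b + j + 1) ≤ cutCount Q 0 (b + j + 2) := by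
    induction s with
    | zero =>
      rw [c.cut.zero, c.al_zero _ (by omega)]
      exact le_rfl
    | succ s ih =>
      have h1 := c.cut.lat s (b + j + 1)
      have h2 := cutCount_succ Q s (b + j + 1)
      have h3 := c.cut.mono s (b + j + 1)
      have e : b + j + 1 + 1 = b + j + 2 := rfl
      rw [e] at h1 h2
      omega
  have h1 := c.cut.count_le c.lam_zero 0 (b + j + 2)
  have h2 := c.be_zero
  omega

/-- A path along which a cell is pushed from row `w` downwards, the letter `s` leaving row
`rho (s + 1)` being the first one below row `rho s`. -/
structure PushPath (w i : ℕ) (Q : ℕ → ℕ → ℕ) (rho : ℕ → ℕ) : Prop where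
  start : rho 0 = w
  step : ∀ s, s < i → (rho s = w ∧ rho (s + 1) = w) ∨
    (rho s < rho (s + 1) ∧ Q s (rho (s + 1)) < Q (s + 1) (rho (s + 1)) ∧
      ∀ r, rho s < r → r < rho (s + 1) → Q (s + 1) r = Q s r)
  turn : ∀ s, s < i → rho (s + 1) = w → (s + 1 = i ∨ w < rho (s + 2)) →
    cutCount Q (s + 1) (w + 1) < cutCount Q s w

theorem PushPath.ge {w i : ℕ} {Q : ℕ → ℕ → ℕ} {rho : ℕ → ℕ} (p : PushPath w i Q rho) {s : ℕ}
    (hs : s ≤ i) : w ≤ rho s := by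
  induction s with
  | zero => exact p.start.ge
  | succ s ih =>
    have := ih (by omega)
    rcases p.step s (by omega) with h | h <;> omega

theorem PushPath.turn' {w i : ℕ} {Q : ℕ → ℕ → ℕ} {rho : ℕ → ℕ} (p : PushPath w i Q rho) {s : ℕ}
    (hs : s < i) (he : rho (s + 1) = w) (hor : s + 1 = i ∨ w < rho (s + 2)) :
    cutCount Q (s + 1) (rho (s + 1) + 1) < cutCount Q s (rho (s + 1)) := by
  rw [he]
  exact p.turn s hs he hor

theorem cutCount_eq_of_eq {Q : ℕ → ℕ → ℕ} {s x y : ℕ} (hxy : x ≤ y)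
    (h : ∀ r, x ≤ r → r < y → Q (s + 1) r = Q s r) : cutCount Q s y = cutCount Q s x := by
  induction y, hxy using Nat.le_induction with
  | base => rfl
  | succ y hy ih =>
    rw [cutCount_succ, ih fun r h1 h2 => h r h1 (by omega), h y hy (by omega)]
    omega

theorem PushPath.validMove {b j K : ℕ} {lam al be : ℕ → ℕ} {Q : ℕ → ℕ → ℕ} {rho : ℕ → ℕ}
    (c : CutSetup b j K lam al be Q) (p : PushPath (b + j) (j + 1) Q rho) :
    ValidMove K (j + 1) Q rho := by
  have hb := c.be_zero
  have pos : ∀ s, s ≤ j + 1 → 1 ≤ Q s (rho s) := by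
    intro s hs
    cases s with
    | zero =>
      rw [p.start]
      have := c.last_row 0
      omega
    | succ s =>
      rcases p.step s (by omega) with h | h
      · rw [h.2]
        have := c.last_row (s + 1)
        omega
      · omega
  refine ⟨fun s hs => ?_, pos, fun s hs hne => ?_, fun s hs hne => ?_, fun s r hs => ?_,
    fun s r hs => ?_⟩
  · by_contra! hK
    have h1 := c.lam_zero _ hK
    have h2 := c.cut.le_top s (rho s)
    have := pos s hs
    omega
  · rcases p.step s hs with h | h
    · exact absurd (h.2.trans h.1.symm) hne
    · exact h.2.1
  · have hw := p.ge hs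
    rcases hw.eq_or_lt with e | hlt
    · rw [← e]
      have h1 := c.last_row s
      have h2 := c.next_row (s + 1)
      omega
    · obtain ⟨t, rfl⟩ : ∃ t, s = t + 1 := by
        cases s with
        | zero => exact absurd p.start hlt.ne'
        | succ t => exact ⟨t, rfl⟩
      have h1 : Q (t + 1 + 1) (rho (t + 1) + 1) = Q (t + 1) (rho (t + 1) + 1) := by
        rcases hs.eq_or_lt with e | hs'
        · rw [e, c.cut.top _ _ le_rfl, c.cut.top _ _ (Nat.le_succ _)]
        · rcases p.step (t + 1) hs' with h | h
          · omega
          · exact h.2.2 _ (by omega) (by omega)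
      have h2 := c.cut.col t (rho (t + 1))
      rcases p.step t (by omega) with h | h <;> omega
  · have h1 := c.cut.lat s r
    rcases lt_trichotomy r (rho (s + 1)) with hr | hr | hr
    · rw [if_neg (by omega), if_neg (by omega)]
      omega
    · subst hr
      rw [if_pos le_rfl, if_neg (lt_irrefl _)]
      rcases p.step s (by omega) with h | h
      · rcases (p.ge hs).eq_or_lt with e | hlt
        · rw [if_pos (show rho (s + 2) ≤ rho (s + 1) by omega)]
          omega
        · have := p.turn' (by omega) h.2 (Or.inr hlt)
          omega
      · rw [if_pos h.1]
        omega
    · rw [if_pos hr.le, if_pos hr]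
      by_cases hc : rho (s + 2) ≤ r
      · rw [if_pos hc]
        rcases p.step s (by omega) with h | h
        · rw [if_pos (by omega)]
          omega
        · rw [if_pos (by omega)]
          omega
      · have h2 := p.ge hs
        rw [if_neg hc]
        have h3 : cutCount Q (s + 1) (r + 1) = cutCount Q (s + 1) (rho (s + 1) + 1) := by
          rcases p.step (s + 1) (by omega) with h | h
          · have e : s + 1 + 1 = s + 2 := rfl
            rw [e] at h
            omega
          · exact cutCount_eq_of_eq (by omega) fun x _ _ =>
              h.2.2 x (by omega) (by have e : s + 1 + 1 = s + 2 := rfl; rw [e]; omega)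
        have h4 := cutCount_mono Q s (Nat.succ_le_of_lt hr)
        have h5 := cutCount_succ Q s (rho (s + 1))
        have h6 := c.cut.lat s (rho (s + 1))
        have e : (rho (s + 1)).succ = rho (s + 1) + 1 := rfl
        rw [e] at h4
        rcases p.step s (by omega) with h | h
        · have := p.turn' (by omega) h.2 (Or.inr (by omega))
          rw [if_pos (by omega)]
          omega
        · rw [if_pos (by omega)]
          omega
  · have hsi : rho (j + 1) = rho (s + 1) := by rw [hs]
    rw [hsi]
    rcases lt_trichotomy r (rho (s + 1)) with hr | hr | hr
    · rw [if_neg (by omega), if_neg (by omega)]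
      omega
    · subst hr
      rw [if_pos le_rfl, if_neg (lt_irrefl _)]
      rcases p.step s (by omega) with h | h
      · have := p.turn' (by omega) h.2 (Or.inl hs)
        omega
      · rw [if_pos h.1]
        omega
    · rw [if_pos hr.le, if_pos hr]
      have h4 := cutCount_mono Q s (Nat.succ_le_of_lt hr)
      have h5 := cutCount_succ Q s (rho (s + 1))
      have e : (rho (s + 1)).succ = rho (s + 1) + 1 := rfl
      rw [e] at h4
      rcases p.step s (by omega) with h | h
      · have := p.turn' (by omega) h.2 (Or.inl hs)
        rw [if_pos (by omega)]
        omega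
      · rw [if_pos (by omega)]
        omega

theorem moveCut_last_eq {lam al be al' be' : ℕ → ℕ} {K i : ℕ} {Q₁ Q₂ : ℕ → ℕ → ℕ}
    {rho rho' : ℕ → ℕ} (h₁ : IsCut lam al be K i Q₁) (h₂ : IsCut lam al' be' K i Q₂)
    (v₁ : ValidMove K i Q₁ rho) (he : moveCut i rho Q₁ = moveCut i rho' Q₂) :
    rho i = rho' i := by
  have h := congrFun (congrFun he i) (rho i)
  have h1 := v₁.pos i le_rfl
  simp only [moveCut, le_refl, true_and, if_true, h₁.top i _ le_rfl, h₂.top i _ le_rfl] at h h1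
  by_contra hne
  rw [if_neg (Ne.symm hne)] at h
  omega

theorem PushPath.not_lt_of_moveCut_eq {b j K : ℕ} {lam al be : ℕ → ℕ} {Q₁ Q₂ : ℕ → ℕ → ℕ}
    {rho rho' : ℕ → ℕ} (c₂ : CutSetup b j K lam al be Q₂)
    (p₁ : PushPath (b + j) (j + 1) Q₁ rho) (p₂ : PushPath (b + j) (j + 1) Q₂ rho')
    (he : moveCut (j + 1) rho Q₁ = moveCut (j + 1) rho' Q₂) {s : ℕ} (hs : s < j + 1)
    (hnext : rho (s + 1) = rho' (s + 1)) : ¬ rho s < rho' s := by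
  intro hlt
  have hge := p₁.ge hs.le
  have hge' := p₂.ge hs.le
  rcases p₂.step s hs with h' | h'
  · omega
  rcases p₁.step s hs with h | h
  · omega
  have e := h.2.2 (rho' s) hlt (by omega)
  have e1 := congrFun (congrFun he s) (rho' s)
  have e2 := congrFun (congrFun he (s + 1)) (rho' s)
  have hpos := (p₂.validMove c₂).pos s hs.le
  have hm := c₂.cut.mono s (rho' s)
  simp only [moveCut, and_true] at e1 e2
  split_ifs at e1 e2 <;> omega

theorem PushPath.cut_eq {b j K : ℕ} {lam al be : ℕ → ℕ} {Q₁ Q₂ : ℕ → ℕ → ℕ}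
    {rho rho' : ℕ → ℕ} (c₁ : CutSetup b j K lam al be Q₁) (c₂ : CutSetup b j K lam al be Q₂)
    (p₁ : PushPath (b + j) (j + 1) Q₁ rho) (p₂ : PushPath (b + j) (j + 1) Q₂ rho')
    (he : moveCut (j + 1) rho Q₁ = moveCut (j + 1) rho' Q₂) : Q₁ = Q₂ := by
  refine moveCut_injective (p₁.validMove c₁) (p₂.validMove c₂) (fun s hs => ?_) he
  induction hs using Nat.decreasingInduction with
  | self => exact moveCut_last_eq c₁.cut c₂.cut (p₁.validMove c₁) he
  | of_succ s hs ih =>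
    have h1 := p₁.not_lt_of_moveCut_eq c₂ p₂ he hs ih
    have h2 := p₂.not_lt_of_moveCut_eq c₁ p₁ he.symm hs ih.symm
    omega

/-- The push path staying in row `w` up to the letter `k`. -/
noncomputable def pushRow (Q : ℕ → ℕ → ℕ) (w k : ℕ) : ℕ → ℕ
  | 0 => w
  | s + 1 => if s < k then w else sInf {r | pushRow Q w k s < r ∧ Q s r < Q (s + 1) r}

theorem pushRow_of_le (Q : ℕ → ℕ → ℕ) (w k s : ℕ) (hs : s ≤ k) : pushRow Q w k s = w := by
  cases s with
  | zero => rfl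
  | succ s => exact if_pos hs

theorem CutSetup.exists_next {b j K : ℕ} {lam al be : ℕ → ℕ} {Q : ℕ → ℕ → ℕ}
    (c : CutSetup b j K lam al be Q) {s x : ℕ} (hs : s ≤ j)
    (hx : cutCount Q s (x + 1) < be j) : ∃ r, x < r ∧ Q s r < Q (s + 1) r := by
  by_contra! hno
  have h1 := c.be_min s hs
  rw [← c.cut.content s] at h1
  have h2 : cutCount Q s (max K (x + 1)) = cutCount Q s (x + 1) :=
    cutCount_eq_of_eq (le_max_right _ _) fun r hr _ => (hno r hr).antisymm (c.cut.mono s r)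
  have h3 := cutCount_mono Q s (le_max_left K (x + 1))
  omega

theorem CutSetup.pushPath {b j K : ℕ} {lam al be : ℕ → ℕ} {Q : ℕ → ℕ → ℕ}
    (c : CutSetup b j K lam al be Q) {k : ℕ} (hk : k ≤ j + 1)
    (hk1 : ∀ s, k = s + 1 → cutCount Q k (b + j + 1) < cutCount Q s (b + j))
    (hk2 : k ≤ j → cutCount Q k (b + j + 1) < be j) :
    PushPath (b + j) (j + 1) Q (pushRow Q (b + j) k) := by
  set rho := pushRow Q (b + j) k with hrho
  have hsucc : ∀ s, k ≤ s → rho (s + 1) = sInf {r | rho s < r ∧ Q s r < Q (s + 1) r} :=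
    fun s hs => if_neg (by omega)
  have hle : ∀ s, s ≤ k → rho s = b + j := fun s hs => pushRow_of_le Q _ k s hs
  have next : ∀ s, k ≤ s → s ≤ j → cutCount Q s (rho s + 1) < be j → rho s < rho (s + 1) ∧
      Q s (rho (s + 1)) < Q (s + 1) (rho (s + 1)) ∧
      ∀ r, rho s < r → r < rho (s + 1) → Q (s + 1) r = Q s r := by
    intro s hs hsj hx
    have hmem : sInf {r | rho s < r ∧ Q s r < Q (s + 1) r} ∈
        {r | rho s < r ∧ Q s r < Q (s + 1) r} := Nat.sInf_mem (c.exists_next hsj hx)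
    have hlt := fun r => Nat.notMem_of_lt_sInf (s := {r | rho s < r ∧ Q s r < Q (s + 1) r})
      (m := r)
    rw [← hsucc s hs] at hmem hlt
    refine ⟨hmem.1, hmem.2, fun r hr hr' => ?_⟩
    have h3 := hlt r hr'
    have h4 := c.cut.mono s r
    simp only [Set.mem_ofPred_eq, not_and, not_lt] at h3
    exact (h3 hr).antisymm h4
  have inv : ∀ s, k ≤ s → s ≤ j → cutCount Q s (rho s + 1) < be j := by
    intro s hs
    induction s, hs using Nat.le_induction with
    | base =>
      rw [hle k le_rfl]
      exact hk2
    | succ s hs ih =>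
      intro hsj
      have hx := ih (by omega)
      obtain ⟨h1, -, h2⟩ := next s hs (by omega) hx
      have h3 := c.cut.lat s (rho (s + 1))
      have h4 : cutCount Q s (rho (s + 1)) = cutCount Q s (rho s + 1) :=
        cutCount_eq_of_eq h1 fun r hr hr' => h2 r hr hr'
      omega
  have hge : ∀ s, s ≤ j + 1 → b + j ≤ rho s := by
    intro s
    induction s with
    | zero => exact fun _ => (hle 0 (Nat.zero_le _)).ge
    | succ s ih =>
      intro hs
      rcases lt_or_ge s k with h | h
      · exact (hle (s + 1) h).ge
      · have := next s h (by omega) (inv s h (by omega))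
        have := ih (by omega)
        omega
  refine ⟨hle 0 (Nat.zero_le _), fun s hs => ?_, fun s hs he hor => ?_⟩
  · rcases lt_or_ge s k with h | h
    · exact Or.inl ⟨hle s h.le, hle (s + 1) h⟩
    · exact Or.inr (next s h (by omega) (inv s h (by omega)))
  · have hks : k = s + 1 := by
      rcases lt_trichotomy k (s + 1) with h | h | h
      · have := next s (by omega) (by omega) (inv s (by omega) (by omega))
        have := hge s (by omega)
        omega
      · exact h
      · rcases hor with h' | h'
        · omega
        · have := hle (s + 2) h
          omega
    have := hk1 s hks
    rwa [hks] at this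

theorem CutSetup.exists_pushPath {b j K : ℕ} {lam al be : ℕ → ℕ} {Q : ℕ → ℕ → ℕ}
    (c : CutSetup b j K lam al be Q) (hlam : lam (b + j) < b + be j) :
    ∃ rho, PushPath (b + j) (j + 1) Q rho := by
  suffices h : ∃ k, k ≤ j + 1 ∧
      (∀ s, k = s + 1 → cutCount Q k (b + j + 1) < cutCount Q s (b + j)) ∧
      (k ≤ j → cutCount Q k (b + j + 1) < be j) by
    obtain ⟨k, hk, hk1, hk2⟩ := h
    exact ⟨_, c.pushPath hk hk1 hk2⟩
  by_contra! hno
  have key : ∀ d, d ≤ j + 1 → cutCount Q d (b + j + 1) + Q d (b + j) ≤ lam (b + j) := by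
    intro d hd
    induction hd using Nat.decreasingInduction with
    | self =>
      rw [c.cut.count_top le_rfl]
      have := c.cut.le_top (j + 1) (b + j)
      omega
    | of_succ d hd ih =>
      have h1 := c.last_row (d + 1)
      have h2 : cutCount Q d (b + j) ≤ cutCount Q (d + 1) (b + j + 1) := by
        by_contra! hlt
        have h3 := hno (d + 1) hd (fun s hs => by
          obtain rfl : s = d := by omega
          exact hlt)
        omega
      have h3 := cutCount_succ Q d (b + j)
      have h4 := c.cut.mono d (b + j)
      omega
  have h1 := key 0 (Nat.zero_le _)
  have h2 := c.last_row 0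
  have h3 := hno 0 (Nat.zero_le _) (fun s hs => by omega)
  omega

/-- The exceptional situation, in which the last row of the square is filled up to its last
but one cell. -/
structure FullSetup (b j K : ℕ) (lam al be : ℕ → ℕ) (Q : ℕ → ℕ → ℕ) : Prop
    extends CutSetup b j K lam al be Q where
  two_le : 2 ≤ j
  be_last : be j = j
  be_le : ∀ s, 1 ≤ s → be s ≤ j + 1
  be_first : j + 2 ≤ be 0
  al_diag : al b < b + j
  al_before : ∀ x, x + 1 = b → al x ≤ b + j
  al_after : al (b + 1) = b
  lam_last : lam (b + j) = b + j

namespace FullSetup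

variable {b j K : ℕ} {lam al be : ℕ → ℕ} {Q : ℕ → ℕ → ℕ}

theorem b_pos (f : FullSetup b j K lam al be Q) : 0 < b := by
  have := f.be_zero
  omega

theorem cut_below_diag (f : FullSetup b j K lam al be Q) {t : ℕ} (ht : t ≤ j) :
    Q (t + 1) (b + t) = b + j := by
  have up : ∀ t, Q (t + 1) (b + t) ≤ b + j := by
    intro t
    induction t with
    | zero =>
      have hb := f.b_pos
      obtain ⟨x, rfl⟩ : ∃ x, b = x + 1 := ⟨b - 1, by omega⟩
      have h1 := f.cut.col 0 x
      rw [f.cut.zero] at h1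
      exact h1.trans (f.al_before x rfl)
    | succ t ih => exact (f.cut.col (t + 1) (b + t)).trans ih
  have down : b + j ≤ Q (t + 1) (b + t) := by
    induction ht using Nat.decreasingInduction with
    | self => rw [f.cut.top _ _ le_rfl, f.lam_last]
    | of_succ t _ ih => exact ih.trans (f.cut.col (t + 1) (b + t))
  exact (up t).antisymm down

theorem cut_above_diag (f : FullSetup b j K lam al be Q) {t r : ℕ} (h1 : b + t + 1 ≤ r)
    (h2 : r ≤ b + j) : Q t r = b := by
  have up : Q t (b + t + 1) ≤ b := by
    clear h1
    induction t with
    | zero =>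
      rw [f.cut.zero]
      exact f.al_after.le
    | succ t ih => exact (f.cut.col t (b + t + 1)).trans ih
  have h3 := f.cut.antitone_right t h1
  have h4 := f.cut.antitone_right t h2
  have h5 := f.last_row t
  omega

theorem diag_lt (f : FullSetup b j K lam al be Q) (t : ℕ) : Q t (b + t) < b + j := by
  induction t with
  | zero =>
    rw [f.cut.zero]
    exact f.al_diag
  | succ t ih => exact (f.cut.col t (b + t)).trans_lt ih

theorem diag_ge (f : FullSetup b j K lam al be Q) {t : ℕ} (ht : t ≤ j) : b ≤ Q t (b + t) :=
  (f.last_row t).trans (f.cut.antitone_right t (by omega))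

theorem count_diag (f : FullSetup b j K lam al be Q) {t : ℕ} (ht : t ≤ j) :
    cutCount Q t (b + t + 1) + Q t (b + t) = cutCount Q t (b + t) + b + j := by
  have h1 := cutCount_succ Q t (b + t)
  have h2 := f.cut_below_diag ht
  have h3 := f.diag_lt t
  omega

theorem count_after (f : FullSetup b j K lam al be Q) {t r : ℕ} (ht : t < j)
    (h1 : b + t + 2 ≤ r) (h2 : r ≤ b + j + 1) :
    cutCount Q t r + Q t (b + t) = cutCount Q t (b + t) + j + Q (t + 1) (b + t + 1) := by
  have h3 := f.count_diag ht.le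
  have h4 := cutCount_succ Q t (b + t + 1)
  have h5 := f.cut_above_diag (t := t) (r := b + t + 1) le_rfl (by omega)
  have h6 := f.diag_ge (t := t + 1) ht
  have h7 : cutCount Q t r = cutCount Q t (b + t + 2) :=
    cutCount_eq_of_eq h1 fun x hx hx' => by
      rw [f.cut_above_diag (t := t + 1) (by omega) (by omega),
        f.cut_above_diag (t := t) (by omega) (by omega)]
  have e : b + t + 1 + 1 = b + t + 2 := rfl
  have e' : b + (t + 1) = b + t + 1 := rfl
  rw [e] at h4
  rw [e'] at h6
  omega

theorem count_last (f : FullSetup b j K lam al be Q) {r : ℕ} (hr : b + j < r) :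
    1 ≤ cutCount Q j r := by
  have h1 := f.count_diag le_rfl
  have h2 := f.diag_lt j
  have h3 := cutCount_mono Q j (Nat.succ_le_of_lt hr)
  have e : (b + j).succ = b + j + 1 := rfl
  rw [e] at h3
  omega

theorem lat_diag (f : FullSetup b j K lam al be Q) {t : ℕ} (ht : t < j) :
    cutCount Q (t + 1) (b + t + 1) + Q t (b + t) ≤
      cutCount Q t (b + t) + Q (t + 1) (b + t + 1) := by
  have h1 := f.count_diag ht.le
  have h2 := f.count_diag (t := t + 1) ht
  have h3 := f.cut.lat t (b + t + 1)
  have e : b + (t + 1) = b + t + 1 := rfl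
  rw [e] at h2
  omega

theorem diag_succ_le (f : FullSetup b j K lam al be Q) (t : ℕ) :
    Q (t + 1) (b + t + 1) ≤ Q t (b + t) :=
  f.cut.col t (b + t)

end FullSetup

/-- A cell pushed from row `b + j` to the diagonal through row `e` and then along it. -/
def diagRow (b j d e : ℕ) : ℕ → ℕ :=
  fun s => if s < d then b + j else if s = d then e else b + (s - 1)

theorem diagRow_lt {b j d e s : ℕ} (h : s < d) : diagRow b j d e s = b + j := if_pos h

theorem diagRow_self (b j d e : ℕ) : diagRow b j d e d = e := by simp [diagRow]

theorem diagRow_gt {b j d e s : ℕ} (h : d ≤ s) : diagRow b j d e (s + 1) = b + s := by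
  have h1 : ¬ s + 1 < d := by omega
  have h2 : ¬ s + 1 = d := by omega
  simp [diagRow, h1, h2]

theorem diagRow_le {b j d s : ℕ} (h : s ≤ d) : diagRow b j d (b + j) s = b + j := by
  rcases h.eq_or_lt with rfl | h
  · exact diagRow_self _ _ _ _
  · exact diagRow_lt h

namespace FullSetup

variable {b j K : ℕ} {lam al be : ℕ → ℕ} {Q : ℕ → ℕ → ℕ}

theorem validMove_direct (f : FullSetup b j K lam al be Q) {d : ℕ} (hd : d ≤ j)
    (hlt : d < j → cutCount Q (d + 1) (b + d + 1) + Q d (b + d) <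
      cutCount Q d (b + d) + Q (d + 1) (b + d + 1))
    (hlast : d = j → 1 ≤ cutCount Q j (b + j)) :
    ValidMove K (j + 1) Q (diagRow b j d (b + j)) := by
  have hb := f.b_pos
  have hrows := f.rows
  refine ⟨fun s hs => ?_, fun s hs => ?_, fun s hs hne => ?_, fun s hs hne => ?_,
    fun s r hs => ?_, fun s r hs => ?_⟩
  · unfold diagRow
    split_ifs <;> omega
  · rcases le_or_gt s d with h | h
    · rw [diagRow_le h]
      have := f.last_row s
      omega
    · obtain ⟨t, rfl⟩ : ∃ t, s = t + 1 := ⟨s - 1, by omega⟩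
      rw [diagRow_gt (by omega), f.cut_below_diag (by omega)]
      omega
  · rcases lt_or_ge s d with h | h
    · rw [diagRow_le h.le, diagRow_le (Nat.succ_le_of_lt h)] at hne
      exact absurd rfl hne
    · rw [diagRow_gt h, f.cut_below_diag (by omega)]
      exact f.diag_lt s
  · have row : diagRow b j d (b + j) s = b + j → Q (s + 1) (diagRow b j d (b + j) s + 1) <
        Q s (diagRow b j d (b + j) s) := by
      intro e
      rw [e]
      have h1 := f.last_row s
      have h2 := f.next_row (s + 1)
      omega
    rcases le_or_gt s d with h | h
    · exact row (diagRow_le h)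
    · obtain ⟨t, rfl⟩ : ∃ t, s = t + 1 := ⟨s - 1, by omega⟩
      rcases hne with h' | h'
      · refine row ?_
        rw [diagRow_gt (by omega)]
        omega
      · rw [diagRow_gt (by omega), diagRow_gt (by omega)] at h'
        omega
  · have hl := f.cut.lat s r
    rcases lt_trichotomy s d with h | h | h
    · rw [diagRow_le h.le, diagRow_le (Nat.succ_le_of_lt h)]
      have : diagRow b j d (b + j) (s + 2) ≤ b + j := by
        unfold diagRow
        split_ifs <;> omega
      split_ifs <;> omega
    · subst h
      rw [diagRow_le le_rfl, diagRow_gt le_rfl, diagRow_gt (Nat.le_succ s)]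
      have h1 := hlt (by omega)
      have h2 := f.diag_succ_le s
      have h3 := f.count_diag (t := s) (by omega)
      have h4 := f.count_diag (t := s + 1) (by omega)
      have e' : b + (s + 1) = b + s + 1 := rfl
      rw [e'] at h4 ⊢
      suffices hs' : b + s ≤ r → r ≤ b + j →
          cutCount Q (s + 1) (r + 1) < cutCount Q s r by
        split_ifs <;> omega
      intro hr1 hr2
      rcases hr1.eq_or_lt with rfl | hr1
      · omega
      rcases (Nat.succ_le_of_lt hr1).eq_or_lt with rfl | hr1
      · have e : (b + s).succ = b + s + 1 := rfl
        rw [e]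
        omega
      · have h5 := f.count_after (t := s) (r := r) (by omega) (by omega) (by omega)
        have h6 := f.count_after (t := s + 1) (r := r + 1) (by omega) (by omega) (by omega)
        have h7 := f.diag_succ_le (s + 1)
        rw [e'] at h6 h7
        omega
    · obtain ⟨t, rfl⟩ : ∃ t, s = t + 1 := ⟨s - 1, by omega⟩
      rw [diagRow_gt (by omega), diagRow_gt (by omega), diagRow_gt (by omega)]
      split_ifs <;> omega
  · obtain rfl : s = j := by omega
    rw [diagRow_gt hd]
    have h1 := f.count_last (r := r)
    rcases hd.eq_or_lt with rfl | h
    · rw [diagRow_self]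
      have h2 := hlast rfl
      by_cases e : r = b + d
      · rw [e]
        split_ifs <;> omega
      · split_ifs <;> omega
    · obtain ⟨t, rfl⟩ : ∃ t, s = t + 1 := ⟨s - 1, by omega⟩
      rw [diagRow_gt (by omega)]
      split_ifs <;> omega

theorem validMove_indirect (f : FullSetup b j K lam al be Q) {d : ℕ} (hd0 : 1 ≤ d) (hd : d < j)
    (hlt : Q (d + 1) (b + d + 1) < Q d (b + d)) :
    ValidMove K (j + 1) Q (diagRow b j d (b + d)) := by
  have hb := f.b_pos
  have hrows := f.rows
  refine ⟨fun s hs => ?_, fun s hs => ?_, fun s hs hne => ?_, fun s hs hne => ?_,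
    fun s r hs => ?_, fun s r hs => ?_⟩
  · unfold diagRow
    split_ifs <;> omega
  · rcases lt_trichotomy s d with h | h | h
    · rw [diagRow_lt h]
      have := f.last_row s
      omega
    · subst h
      rw [diagRow_self]
      omega
    · obtain ⟨t, rfl⟩ : ∃ t, s = t + 1 := ⟨s - 1, by omega⟩
      rw [diagRow_gt (by omega), f.cut_below_diag (by omega)]
      omega
  · rcases lt_trichotomy (s + 1) d with h | h | h
    · rw [diagRow_lt h, diagRow_lt (by omega)] at hne
      exact absurd rfl hne
    · subst h
      rw [diagRow_self, f.cut_above_diag (by omega) (by omega)]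
      have := f.diag_ge (t := s + 1 + 1) (by omega)
      have e : b + (s + 1 + 1) = b + (s + 1) + 1 := rfl
      rw [e] at this
      omega
    · rw [diagRow_gt (by omega), f.cut_below_diag (by omega)]
      exact f.diag_lt s
  · have row : diagRow b j d (b + d) s = b + j → Q (s + 1) (diagRow b j d (b + d) s + 1) <
        Q s (diagRow b j d (b + d) s) := by
      intro e
      rw [e]
      have h1 := f.last_row s
      have h2 := f.next_row (s + 1)
      omega
    rcases lt_trichotomy s d with h | h | h
    · exact row (diagRow_lt h)
    · subst h
      rw [diagRow_self]
      exact hlt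
    · obtain ⟨t, rfl⟩ : ∃ t, s = t + 1 := ⟨s - 1, by omega⟩
      rcases hne with h' | h'
      · refine row ?_
        rw [diagRow_gt (by omega)]
        omega
      · rw [diagRow_gt (by omega), diagRow_gt (by omega)] at h'
        omega
  · have hl := f.cut.lat s r
    rcases lt_trichotomy (s + 1) d with h | h | h
    · rw [diagRow_lt (show s < d by omega), diagRow_lt h]
      have : diagRow b j d (b + d) (s + 2) ≤ b + j := by
        unfold diagRow
        split_ifs <;> omega
      split_ifs <;> omega
    · subst h
      rw [diagRow_lt (Nat.lt_succ_self s), diagRow_self, diagRow_gt le_rfl]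
      suffices hs' : b + (s + 1) < r → r ≤ b + j →
          cutCount Q (s + 1) (r + 1) < cutCount Q s r by
        split_ifs <;> omega
      intro hr1 hr2
      have h5 := f.count_after (t := s) (r := r) (by omega) (by omega) (by omega)
      have h6 := f.count_after (t := s + 1) (r := r + 1) (by omega) (by omega) (by omega)
      have h7 := f.lat_diag (t := s) (by omega)
      have e' : b + (s + 1) = b + s + 1 := rfl
      rw [e'] at h6 hlt
      omega
    · rcases (Nat.lt_succ_iff.1 h).eq_or_lt with h | h
      · subst h
        rw [diagRow_self, diagRow_gt le_rfl, diagRow_gt (Nat.le_succ d)]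
        have h7 := f.lat_diag hd
        by_cases e : r = b + d
        · rw [e]
          split_ifs <;> omega
        · split_ifs <;> omega
      · obtain ⟨t, rfl⟩ : ∃ t, s = t + 1 := ⟨s - 1, by omega⟩
        rw [diagRow_gt (by omega), diagRow_gt (by omega), diagRow_gt (by omega)]
        split_ifs <;> omega
  · obtain rfl : s = j := by omega
    rw [diagRow_gt hd.le]
    have h1 := f.count_last (r := r)
    obtain ⟨t, rfl⟩ : ∃ t, s = t + 1 := ⟨s - 1, by omega⟩
    rw [diagRow_gt (by omega)]
    split_ifs <;> omega

end FullSetup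

/-- A cell pushed from row `b + j` to the next row, its last letter leaving row `e`. -/
def lowRow (b j e : ℕ) : ℕ → ℕ :=
  fun s => if s = 0 then b + j else if s ≤ j then b + j + 1 else e

theorem lowRow_zero (b j e : ℕ) : lowRow b j e 0 = b + j := if_pos rfl

theorem lowRow_mid {b j e s : ℕ} (h0 : s ≠ 0) (h : s ≤ j) : lowRow b j e s = b + j + 1 := by
  rw [lowRow, if_neg h0, if_pos h]

theorem lowRow_last (b j e : ℕ) : lowRow b j e (j + 1) = e := by
  rw [lowRow, if_neg (Nat.succ_ne_zero j), if_neg (Nat.not_succ_le_self j)]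

/-- The shape of a cut matrix for which no cell can be pushed to the diagonal. -/
structure LowCut (b j : ℕ) (be : ℕ → ℕ) (Q : ℕ → ℕ → ℕ) : Prop where
  count : ∀ t, t < j → cutCount Q t (b + j + 1) = j
  row : ∀ s, s ≠ 0 → s ≤ j → Q s (b + j + 1) + j = be 0
  row_succ : ∀ s, s ≤ j → Q s (b + j + 2) ≤ 1

namespace FullSetup

variable {b j K : ℕ} {lam al be : ℕ → ℕ} {Q : ℕ → ℕ → ℕ}

theorem lowCut (f : FullSetup b j K lam al be Q) (hE : cutCount Q j (b + j) = 0)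
    (hlat : ∀ t, t < j → cutCount Q t (b + t) + Q (t + 1) (b + t + 1) ≤
      cutCount Q (t + 1) (b + t + 1) + Q t (b + t))
    (hD : ∀ t, 1 ≤ t → t < j → Q t (b + t) ≤ Q (t + 1) (b + t + 1)) :
    LowCut b j be Q := by
  have h2j := f.two_le
  have hEt : ∀ t, 1 ≤ t → t ≤ j → cutCount Q t (b + t) = 0 := by
    intro t ht1 ht
    induction ht using Nat.decreasingInduction with
    | self => exact hE
    | of_succ t ht ih =>
      have h1 := hlat t ht
      have h2 := f.diag_succ_le t
      have h3 := hD t ht1 ht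
      have h4 := ih (by omega)
      have e : b + (t + 1) = b + t + 1 := rfl
      rw [e] at h4
      omega
  have count : ∀ t, t < j → cutCount Q t (b + j + 1) = j := by
    intro t ht
    have h1 := f.count_after ht (r := b + j + 1) (by omega) le_rfl
    have h2 := hlat t ht
    have h3 := f.lat_diag ht
    have h4 := hEt (t + 1) (by omega) ht
    have e : b + (t + 1) = b + t + 1 := rfl
    rw [e] at h4
    omega
  have zero0 : Q 0 (b + j + 1) = 0 := by rw [f.cut.zero, f.al_zero _ (by omega)]
  have zero1 : ∀ r, b + j + 2 ≤ r → Q 1 r = 0 := by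
    intro r hr
    obtain ⟨x, rfl⟩ : ∃ x, r = x + 1 := ⟨r - 1, by omega⟩
    have h1 := f.cut.col 0 x
    rw [f.cut.zero, f.al_zero _ (by omega)] at h1
    exact Nat.le_zero.1 h1
  have row1 : Q 1 (b + j + 1) + j = be 0 := by
    rw [← f.cut.content 0, cutCount_eq_of_eq (x := b + j + 2) f.rows.le, cutCount_succ,
      count 0 (by omega), zero0]
    · exact Nat.add_comm _ _
    · intro r hr _
      rw [f.cut.zero, f.al_zero _ (by omega)]
      exact zero1 r hr
  have row : ∀ s, s ≠ 0 → s ≤ j → Q s (b + j + 1) = Q 1 (b + j + 1) := by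
    intro s hs
    induction s, Nat.one_le_iff_ne_zero.2 hs using Nat.le_induction with
    | base => exact fun _ => rfl
    | succ s hs1 ih =>
      intro hsj
      obtain ⟨t, rfl⟩ : ∃ t, s = t + 1 := ⟨s - 1, by omega⟩
      have h1 := f.cut.lat t (b + j + 1)
      rw [cutCount_succ, count _ (by omega), count _ (by omega)] at h1
      have h2 := f.cut.mono (t + 1) (b + j + 1)
      have h3 := ih (by omega) (by omega)
      omega
  have count_succ : ∀ t, 1 ≤ t → t < j → cutCount Q t (b + j + 2) = j := by
    intro t ht1 ht
    rw [cutCount_succ, count t ht, row (t + 1) (by omega) ht, row t (by omega) ht.le]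
    omega
  have row_succ : ∀ s, 2 ≤ s → s ≤ j → Q s (b + j + 2) ≤ 1 := by
    intro s hs
    induction s, hs using Nat.le_induction with
    | base =>
      intro _
      have h1 : cutCount Q 1 (b + j + 2) + (Q 2 (b + j + 2) - Q 1 (b + j + 2)) ≤ be 1 :=
        (cutCount_succ Q 1 (b + j + 2)).symm.trans_le (f.cut.count_le f.lam_zero 1 (b + j + 3))
      rw [count_succ 1 le_rfl (by omega), zero1 _ le_rfl] at h1
      have h2 := f.be_le 1 le_rfl
      omega
    | succ s hs2 ih =>
      intro hsj
      obtain ⟨t, rfl⟩ : ∃ t, s = t + 1 := ⟨s - 1, by omega⟩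
      have h1 := f.cut.lat t (b + j + 2)
      rw [cutCount_succ, count_succ _ (by omega) (by omega),
        count_succ _ (by omega) (by omega)] at h1
      have h2 := ih (by omega)
      omega
  refine ⟨count, fun s hs hsj => by rw [row s hs hsj, row1], fun s hsj => ?_⟩
  have h1 := f.cut.mono_left (b + j + 2) (show s ≤ max s 2 by omega)
  exact h1.trans (row_succ _ (by omega) (by omega))

theorem validMove_low (f : FullSetup b j K lam al be Q) (g : LowCut b j be Q) {e : ℕ}
    (he : lam (b + j + 2) + j < be 0 ∧ e = b + j + 1 ∨
      be 0 ≤ lam (b + j + 2) + j ∧ e = b + j + 2) :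
    ValidMove K (j + 1) Q (lowRow b j e) := by
  have hb := f.b_pos
  have h2j := f.two_le
  have hrows := f.rows
  have hfirst := f.be_first
  have last : ∀ s r, j < s → Q s r = lam r := fun s r h => f.cut.top s r h
  have hlast := f.cut.mono j (b + j + 1)
  rw [last (j + 1) _ (by omega)] at hlast
  have hrowj := g.row j (by omega) le_rfl
  have hsuccj := g.row_succ j le_rfl
  refine ⟨fun s hs => ?_, fun s hs => ?_, fun s hs hne => ?_, fun s hs hne => ?_,
    fun s r hs => ?_, fun s r hs => ?_⟩
  · unfold lowRow
    split_ifs <;> omega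
  · rcases Nat.eq_zero_or_pos s with rfl | h0
    · rw [lowRow_zero]
      have := f.last_row 0
      omega
    · rcases hs.eq_or_lt with rfl | h
      · rw [lowRow_last, last _ _ (by omega)]
        rcases he with he | he <;> rw [he.2] <;> omega
      · rw [lowRow_mid h0.ne' (by omega)]
        have := g.row s h0.ne' (by omega)
        omega
  · rcases Nat.eq_zero_or_pos s with rfl | h0
    · rw [lowRow_mid (by omega) (by omega), f.cut.zero, f.al_zero _ (by omega)]
      have := g.row 1 (by omega) (by omega)
      rw [zero_add]
      omega
    · rcases (Nat.succ_le_of_lt hs).eq_or_lt with h | h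
      · obtain rfl : s = j := by omega
        rw [lowRow_mid (s := s) h0.ne' le_rfl, lowRow_last] at hne
        rw [lowRow_last, last (s + 1) _ (by omega)]
        rcases he with he | he
        · exact absurd he.2 hne
        · rw [he.2]
          omega
      · rw [lowRow_mid (by omega) (by omega), lowRow_mid h0.ne' (by omega)] at hne
        exact absurd rfl hne
  · rcases Nat.eq_zero_or_pos s with rfl | h0
    · rw [lowRow_mid (s := 0 + 1) (by omega) (by omega), lowRow_zero] at hne
      omega
    · rcases hs.eq_or_lt with rfl | h
      · rw [lowRow_last, last _ _ (by omega), last _ _ (by omega)]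
        rcases he with he | he <;> rw [he.2]
        · have : b + j + 1 + 1 = b + j + 2 := rfl
          rw [this]
          omega
        · have h3 := f.cut.col j (b + j + 2)
          rw [last _ _ (by omega)] at h3
          omega
      · rw [lowRow_mid (s := s) h0.ne' (by omega)] at hne ⊢
        have hrow := g.row s h0.ne' (by omega)
        have e1 : b + j + 1 + 1 = b + j + 2 := rfl
        rw [e1] at hne ⊢
        rcases (Nat.lt_succ_iff.1 h).eq_or_lt with rfl | h'
        · rw [lowRow_last] at hne
          rw [last _ _ (by omega)]
          omega
        · have := g.row_succ (s + 1) h'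
          omega
  · have hl := f.cut.lat s r
    rw [lowRow_mid (s := s + 1) (by omega) (by omega)]
    rcases Nat.eq_zero_or_pos s with rfl | h0
    · rw [lowRow_mid (s := 0 + 2) (by omega) (by omega), lowRow_zero]
      split_ifs <;> omega
    · rw [lowRow_mid (s := s) (by omega) (by omega)]
      rcases hs.eq_or_lt with h | h
      · obtain rfl : j = s + 1 := by omega
        have e1 : s + 2 = s + 1 + 1 := rfl
        rw [e1, lowRow_last]
        rcases he with he | he
        · rw [he.2]
          split_ifs <;> omega
        · rw [he.2]
          by_cases hr : r = b + (s + 1) + 1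
          · subst hr
            have h1 := g.count s (by omega)
            have h2 := f.cut.count_le f.lam_zero (s + 1) (b + (s + 1) + 3)
            rw [cutCount_succ, last _ _ (by omega), f.be_last] at h2
            have e2 : b + (s + 1) + 1 + 1 = b + (s + 1) + 2 := rfl
            rw [e2]
            split_ifs <;> omega
          · split_ifs <;> omega
      · rw [lowRow_mid (s := s + 2) (by omega) (by omega)]
        split_ifs <;> omega
  · obtain rfl : s = j := by omega
    rw [lowRow_last, lowRow_mid (s := s) (by omega) le_rfl]
    have h1 := f.count_last (r := r)
    rcases he with he | he <;> rw [he.2] <;> split_ifs <;> omega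

/-- The paths used in the exceptional situation. -/
def Path (b j : ℕ) (rho : ℕ → ℕ) : Prop :=
  (∃ d, d ≤ j ∧ rho = diagRow b j d (b + j)) ∨
  (∃ d, 1 ≤ d ∧ d < j ∧ rho = diagRow b j d (b + d)) ∨
  ∃ e, b + j < e ∧ rho = lowRow b j e

theorem exists_validMove (f : FullSetup b j K lam al be Q) :
    ∃ rho, ValidMove K (j + 1) Q rho ∧ Path b j rho := by
  by_cases hE : cutCount Q j (b + j) = 0
  swap
  · exact ⟨_, f.validMove_direct le_rfl (fun h => absurd h (lt_irrefl _)) fun _ => by omega,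
      Or.inl ⟨j, le_rfl, rfl⟩⟩
  by_cases hlat : ∃ d, d < j ∧ cutCount Q (d + 1) (b + d + 1) + Q d (b + d) <
      cutCount Q d (b + d) + Q (d + 1) (b + d + 1)
  · obtain ⟨d, hd, h⟩ := hlat
    exact ⟨_, f.validMove_direct hd.le (fun _ => h) fun h => absurd h hd.ne,
      Or.inl ⟨d, hd.le, rfl⟩⟩
  by_cases hD : ∃ d, 1 ≤ d ∧ d < j ∧ Q (d + 1) (b + d + 1) < Q d (b + d)
  · obtain ⟨d, hd1, hd, h⟩ := hD
    exact ⟨_, f.validMove_indirect hd1 hd h, Or.inr (Or.inl ⟨d, hd1, hd, rfl⟩)⟩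
  push Not at hlat hD
  have g := f.lowCut hE hlat hD
  rcases lt_or_ge (lam (b + j + 2) + j) (be 0) with h | h
  · exact ⟨_, f.validMove_low g (Or.inl ⟨h, rfl⟩), Or.inr (Or.inr ⟨_, by omega, rfl⟩)⟩
  · exact ⟨_, f.validMove_low g (Or.inr ⟨h, rfl⟩), Or.inr (Or.inr ⟨_, by omega, rfl⟩)⟩

theorem Path.start {rho : ℕ → ℕ} (p : Path b j rho) : rho 0 = b + j := by
  rcases p with ⟨d, -, rfl⟩ | ⟨d, h1, -, rfl⟩ | ⟨e, -, rfl⟩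
  · exact diagRow_le (Nat.zero_le d)
  · exact diagRow_lt h1
  · exact lowRow_zero _ _ _

/-- The paths to the diagonal leave row `b + j` at the same letter if the moves agree. -/
theorem diagRow_not_lt {Q₁ Q₂ : ℕ → ℕ → ℕ} (f₁ : FullSetup b j K lam al be Q₁)
    (f₂ : FullSetup b j K lam al be Q₂) {d d' e e' : ℕ} (hd' : d' ≤ j)
    (he : moveCut (j + 1) (diagRow b j d e) Q₁ = moveCut (j + 1) (diagRow b j d' e') Q₂)
    (hor : e' = b + j ∨ e' = b + d') : ¬ d < d' := by
  intro hlt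
  have h := congrFun (congrFun he (d + 1)) (b + d)
  simp only [moveCut] at h
  rw [diagRow_gt le_rfl, f₁.cut_below_diag (by omega), f₂.cut_below_diag (by omega)] at h
  have hne : diagRow b j d' e' (d + 1) ≠ b + d := by
    rcases (Nat.succ_le_of_lt hlt).eq_or_lt with h' | h'
    · obtain rfl : d' = d + 1 := h'.symm
      rw [diagRow_self]
      omega
    · rw [diagRow_lt h']
      omega
  have := f₁.b_pos
  rw [if_pos ⟨by omega, rfl⟩, if_neg (fun h => hne h.2)] at h
  omega

theorem diagRow_ne {Q₁ Q₂ : ℕ → ℕ → ℕ} (f₁ : FullSetup b j K lam al be Q₁)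
    (f₂ : FullSetup b j K lam al be Q₂) {d : ℕ} (hd : d < j) :
    moveCut (j + 1) (diagRow b j d (b + j)) Q₁ ≠ moveCut (j + 1) (diagRow b j d (b + d)) Q₂ := by
  intro he
  have h := congrFun (congrFun he d) (b + j)
  simp only [moveCut] at h
  have := f₁.b_pos
  rw [diagRow_self, diagRow_self, f₁.cut_above_diag (by omega) le_rfl,
    f₂.cut_above_diag (by omega) le_rfl, if_pos ⟨by omega, rfl⟩, if_neg (by omega)] at h
  omega

theorem cut_eq {Q₁ Q₂ : ℕ → ℕ → ℕ} {rho rho' : ℕ → ℕ} (f₁ : FullSetup b j K lam al be Q₁)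
    (f₂ : FullSetup b j K lam al be Q₂) (v₁ : ValidMove K (j + 1) Q₁ rho)
    (v₂ : ValidMove K (j + 1) Q₂ rho') (p₁ : Path b j rho) (p₂ : Path b j rho')
    (he : moveCut (j + 1) rho Q₁ = moveCut (j + 1) rho' Q₂) : Q₁ = Q₂ := by
  have hlast := moveCut_last_eq f₁.cut f₂.cut v₁ he
  suffices h : rho = rho' from moveCut_injective v₁ v₂ (fun s _ => congrFun h s) he
  rcases p₁ with ⟨d, hd, rfl⟩ | ⟨d, hd1, hd, rfl⟩ | ⟨e, hw, rfl⟩ <;>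
    rcases p₂ with ⟨d', hd', rfl⟩ | ⟨d', hd1', hd', rfl⟩ | ⟨e', hw', rfl⟩
  · have h1 := diagRow_not_lt f₁ f₂ hd' he (Or.inl rfl)
    have h2 := diagRow_not_lt f₂ f₁ hd he.symm (Or.inl rfl)
    obtain rfl : d = d' := by omega
    rfl
  · have h1 := diagRow_not_lt f₁ f₂ hd'.le he (Or.inr rfl)
    have h2 := diagRow_not_lt f₂ f₁ hd he.symm (Or.inl rfl)
    obtain rfl : d = d' := by omega
    exact absurd he (diagRow_ne f₁ f₂ hd')
  · rw [lowRow_last, diagRow_gt hd] at hlast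
    omega
  · have h1 := diagRow_not_lt f₁ f₂ hd' he (Or.inl rfl)
    have h2 := diagRow_not_lt f₂ f₁ hd.le he.symm (Or.inr rfl)
    obtain rfl : d = d' := by omega
    exact absurd he.symm (diagRow_ne f₂ f₁ hd)
  · have h1 := diagRow_not_lt f₁ f₂ hd'.le he (Or.inr rfl)
    have h2 := diagRow_not_lt f₂ f₁ hd.le he.symm (Or.inr rfl)
    obtain rfl : d = d' := by omega
    rfl
  · rw [lowRow_last, diagRow_gt hd.le] at hlast
    omega
  · rw [lowRow_last, diagRow_gt hd'] at hlast
    omega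
  · rw [lowRow_last, diagRow_gt hd'.le] at hlast
    omega
  · rw [lowRow_last, lowRow_last] at hlast
    rw [hlast]

end FullSetup

theorem lt_conjP_iff {f : ℕ → ℕ} (hf : IsPartition f) {r s : ℕ} : r < conjP f s ↔ s < f r := by
  have hex : ∃ n, f n ≤ s := hf.2.imp fun N hN => hN.le.trans (Nat.zero_le s)
  have key : ∀ i, s < f i ↔ i < Nat.find hex := by
    intro i
    refine ⟨fun h => ?_, fun h => not_le.1 (Nat.find_min hex h)⟩
    by_contra! hle
    exact absurd ((hf.1 hle).trans (Nat.find_spec hex)) (not_le.2 h)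
  have hcard : conjP f s = Nat.find hex := by
    rw [conjP, Nat.card_congr (Equiv.subtypeEquivRight key)]
    exact (Nat.card_congr Fin.equivSubtype.symm).trans (Nat.card_fin _)
  rw [hcard, key]

theorem plen_eq_conjP {f : ℕ → ℕ} (hf : IsPartition f) : plen f = conjP f 0 := by
  refine le_antisymm (Nat.sInf_le ?_) ?_
  · have := (lt_conjP_iff hf (r := conjP f 0) (s := 0)).not.1 (lt_irrefl _)
    exact Nat.eq_zero_of_not_pos this
  · have hmem : f (plen f) = 0 := Nat.sInf_mem (s := {n | f n = 0}) hf.2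
    have := (lt_conjP_iff hf (r := plen f) (s := 0)).not.2 (by omega)
    omega

theorem conjP_antitone {f : ℕ → ℕ} (hf : IsPartition f) : Antitone (conjP f) := by
  intro s t hst
  by_contra! h
  have h1 := (lt_conjP_iff hf).1 h
  have h2 := (lt_conjP_iff hf (r := conjP f s) (s := s)).not.1 (lt_irrefl _)
  omega

theorem IsPartition.addRow1 {f : ℕ → ℕ} (hf : IsPartition f) (h0 : f 0 ≠ 0) :
    IsPartition (addRow1 f) := by
  refine ⟨fun x y hxy => ?_, hf.2.imp fun N hN => ?_⟩
  · have h1 := hf.1 hxy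
    have h2 := hf.1 (Nat.zero_le y)
    unfold _root_.addRow1
    split_ifs <;> omega
  · have hne : N ≠ 0 := by
      rintro rfl
      exact h0 hN
    rw [_root_.addRow1, if_neg hne, hN]

theorem conjP_addRow1 {f : ℕ → ℕ} (hf : IsPartition f) (h0 : f 0 ≠ 0) (s : ℕ) :
    conjP (addRow1 f) s = conjP f s + if s = f 0 then 1 else 0 := by
  refine eq_of_forall_lt_iff fun r => ?_
  rw [lt_conjP_iff (hf.addRow1 h0)]
  have h1 := hf.1 (Nat.zero_le r)
  have h2 := lt_conjP_iff hf (r := r) (s := s)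
  by_cases hs : s = f 0
  · have h3 := (lt_conjP_iff hf (r := 0) (s := s)).not.2 (by omega)
    rw [if_pos hs]
    unfold addRow1
    split_ifs <;> omega
  · rw [if_neg hs, add_zero, h2]
    unfold addRow1
    split_ifs with hr
    · rw [hr]
      omega
    · rfl

theorem complP_antitone {f : ℕ → ℕ} (hf : Antitone f) (m : ℕ) : Antitone (complP m f) := by
  intro x y hxy
  have := hf (show m - 1 - y ≤ m - 1 - x by omega)
  unfold complP
  split_ifs <;> omega

theorem complP_addRow1 (f : ℕ → ℕ) (m r : ℕ) :
    complP m (addRow1 f) r = complP m f r - if m - 1 = r then 1 else 0 := by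
  unfold complP addRow1
  rcases eq_or_ne (m - 1) r with rfl | h
  · rw [Nat.sub_self]
    split_ifs <;> omega
  · split_ifs <;> omega

theorem CutSetup.fullSetup {nu lam : ℕ → ℕ} {b j K : ℕ} {Q : ℕ → ℕ → ℕ} (h1 : Type1 nu)
    (hnu : nu 0 = j + 1) (hrect : subP (fun x => if x < nu 0 - 1 then nu 0 else 0) nu)
    (c : CutSetup b j K lam (complP (b + j + 1) nu) (conjP nu) Q)
    (hlam : b + conjP nu j ≤ lam (b + j)) :
    FullSetup b j K lam (complP (b + j + 1) nu) (conjP nu) Q := by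
  have hb : 0 < b := by
    have := c.be_zero
    omega
  have h2 := c.be_two
  have h3 := c.be_large
  have hbeta := h1.2
  rw [hnu] at hbeta hrect
  have hal : ∀ x y, x + y = b + j → complP (b + j + 1) nu x = b + j + 1 - nu y := by
    intro x y h
    rw [complP, if_pos (by omega), show b + j + 1 - 1 - x = y by omega]
  have hnext : 1 ≤ nu (j + 1) := by
    refine le_trans ?_ (hbeta (j + 1))
    unfold betaShape
    split_ifs <;> omega
  have chain : ∀ t, t ≤ j → lam (b + j) ≤ Q (t + 1) (b + t) := by
    intro t ht
    induction ht using Nat.decreasingInduction with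
    | self => rw [c.cut.top _ _ le_rfl]
    | of_succ t _ ih => exact ih.trans (c.cut.col (t + 1) (b + t))
  have hbefore : ∀ x, x + 1 = b → complP (b + j + 1) nu x = b + j + 1 - nu (j + 1) :=
    fun x hx => hal x (j + 1) (by omega)
  have hle : lam (b + j) ≤ b + j + 1 - nu (j + 1) := by
    obtain ⟨x, hx⟩ : ∃ x, x + 1 = b := ⟨b - 1, by omega⟩
    have h4 := chain 0 (Nat.zero_le j)
    have h5 := c.cut.col 0 x
    rw [c.cut.zero, hbefore x hx, hx] at h5
    exact h4.trans h5
  have hj : 2 ≤ j := by omega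
  have hdiag : 2 ≤ nu j := by
    refine le_trans ?_ (hbeta j)
    unfold betaShape
    split_ifs <;> omega
  refine ⟨c, hj, by omega, fun s hs => ?_, ?_, ?_, fun x hx => ?_, ?_, by omega⟩
  · by_contra! h
    have := (lt_conjP_iff h1.1).1 h
    omega
  · exact (lt_conjP_iff h1.1).2 hnext
  · rw [hal b j rfl]
    omega
  · rw [hbefore x hx]
    omega
  · have h4 := hrect (j - 1)
    have h5 := h1.1.1 (Nat.zero_le (j - 1))
    rw [hnu] at h5
    dsimp only at h4
    rw [if_pos (by omega)] at h4
    rw [hal (b + 1) (j - 1) (by omega)]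
    omega

/-- a nonempty type-1 partition `ν` containing the rectangle
`(ν₁^{ν₁ - 1})` is covered by `ν + (1)`. -/
theorem type1_large_rectangle_covered (nu : ℕ → ℕ)
    (h1 : Type1 nu) (hne : nu 0 ≠ 0)
    (hrect : subP (fun j => if j < nu 0 - 1 then nu 0 else 0) nu) :
    Covers (addRow1 nu) nu := by
  intro m hm lam hlam
  obtain ⟨j, hnu⟩ : ∃ j, nu 0 = j + 1 := Nat.exists_eq_succ_of_ne_zero hne
  have hp := h1.1
  have hadd := hp.addRow1 hne
  rw [plen_eq_conjP hadd, conjP_addRow1 hp hne, if_neg hne.symm, addRow1, if_pos rfl, hnu] at hm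
  obtain ⟨b, rfl⟩ : ∃ b, m = b + j + 1 := ⟨m - (j + 1), by omega⟩
  have hal : ∀ r, complP (b + j + 1) (addRow1 nu) r =
      complP (b + j + 1) nu r - if b + j = r then 1 else 0 :=
    complP_addRow1 nu (b + j + 1)
  have hbe : ∀ s, conjP (addRow1 nu) s = conjP nu s + if s = j + 1 then 1 else 0 := by
    intro s
    rw [conjP_addRow1 hp hne, hnu]
  have hbe0 : ∀ s, j + 1 ≤ s → conjP nu s = 0 := by
    intro s hs
    have := (lt_conjP_iff hp (r := 0) (s := s)).not.2 (by omega)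
    omega
  have htwo : 2 ≤ conjP nu j := by
    refine (lt_conjP_iff hp).2 (lt_of_lt_of_le ?_ (h1.2 1))
    rw [hnu, betaShape, if_pos (by omega)]
    exact Nat.lt_succ_self j
  have hlarge : j ≤ conjP nu j := by
    by_contra! h
    have h2 := hrect (j - 1)
    dsimp only at h2
    rw [hnu, if_pos (by omega)] at h2
    have := (lt_conjP_iff hp).2 (Nat.lt_of_succ_le h2)
    omega
  obtain ⟨N, hN⟩ := hlam.2
  obtain ⟨K, hNK, hK⟩ : ∃ K, N ≤ K ∧ b + j + 2 < K :=
    ⟨max N (b + j + 3), le_max_left _ _, Nat.lt_of_succ_le (le_max_right _ _)⟩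
  have hlamK : ∀ r, K ≤ r → lam r = 0 := fun r hr =>
    Nat.le_zero.1 (hN ▸ hlam.1 (hNK.trans hr))
  have setup : ∀ Q, IsCut lam (complP (b + j + 1) nu) (conjP nu) K (j + 1) Q →
      CutSetup b j K lam (complP (b + j + 1) nu) (conjP nu) Q := by
    intro Q hQ
    refine ⟨hQ, hlam.1, hlamK, ?_, fun r hr => ?_, by omega,
      fun s hs => conjP_antitone hp hs, htwo, hlarge, hK⟩
    · rw [complP, if_pos (by omega), show b + j + 1 - 1 - (b + j) = 0 by omega, hnu]
      omega
    · rw [complP, if_neg (by omega)]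
  have isCut : ∀ Q rho, IsCut lam (complP (b + j + 1) nu) (conjP nu) K (j + 1) Q →
      ValidMove K (j + 1) Q rho → rho 0 = b + j →
      IsCut lam (complP (b + j + 1) (addRow1 nu)) (conjP (addRow1 nu)) K (j + 2)
        (moveCut (j + 1) rho Q) := by
    intro Q rho hQ v h0
    exact v.isCut hQ (by rwa [h0]) hbe
  have main : ∀ Rel : (ℕ → ℕ → ℕ) → (ℕ → ℕ → ℕ) → Prop,
      (∀ Q, IsCut lam (complP (b + j + 1) nu) (conjP nu) K (j + 1) Q →
        ∃ Q', IsCut lam (complP (b + j + 1) (addRow1 nu)) (conjP (addRow1 nu)) K (j + 2) Q' ∧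
          Rel Q Q') →
      (∀ Q₁ Q₂ Q', IsCut lam (complP (b + j + 1) nu) (conjP nu) K (j + 1) Q₁ →
        IsCut lam (complP (b + j + 1) nu) (conjP nu) K (j + 1) Q₂ →
        Rel Q₁ Q' → Rel Q₂ Q' → Q₁ = Q₂) →
      LRcoeff lam (complP (b + j + 1) nu) (conjP nu) ≤
        LRcoeff lam (complP (b + j + 1) (addRow1 nu)) (conjP (addRow1 nu)) := by
    intro Rel hex hinj
    refine LRcoeff_le_of_cut_relation hlam.1 (complP_antitone hp.1 _)
      (complP_antitone hadd.1 _) (fun r => ?_) hlamK hbe0 (fun s hs => ?_) Rel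
      (fun _ => hex) (fun _ => hinj)
    · rw [hal]
      exact Nat.sub_le _ _
    · rw [hbe, hbe0 s (by omega), if_neg (by omega)]
  rcases lt_or_ge (lam (b + j)) (b + conjP nu j) with hlt | hge
  · refine main (fun Q Q' => ∃ rho, PushPath (b + j) (j + 1) Q rho ∧
      Q' = moveCut (j + 1) rho Q) (fun Q hQ => ?_) ?_
    · obtain ⟨rho, p⟩ := (setup Q hQ).exists_pushPath hlt
      exact ⟨_, isCut Q rho hQ (p.validMove (setup Q hQ)) p.start, rho, p, rfl⟩
    · rintro Q₁ Q₂ Q' hQ₁ hQ₂ ⟨rho, p, rfl⟩ ⟨rho', p', he⟩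
      exact p.cut_eq (setup Q₁ hQ₁) (setup Q₂ hQ₂) p' he
  · have full := fun Q hQ => (setup Q hQ).fullSetup h1 hnu hrect hge
    refine main (fun Q Q' => ∃ rho, (ValidMove K (j + 1) Q rho ∧ FullSetup.Path b j rho) ∧
      Q' = moveCut (j + 1) rho Q) (fun Q hQ => ?_) ?_
    · obtain ⟨rho, v, p⟩ := (full Q hQ).exists_validMove
      exact ⟨_, isCut Q rho hQ v p.start, rho, ⟨v, p⟩, rfl⟩
    · rintro Q₁ Q₂ Q' hQ₁ hQ₂ ⟨rho, ⟨v, p⟩, rfl⟩ ⟨rho', ⟨v', p'⟩, he⟩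
      exact (full Q₁ hQ₁).cut_eq (full Q₂ hQ₂) v v' p p' he
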